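/- arXiv:2111.03684 — 3 statements merged into one kernel-verified Lean document; each statement's English description precedes it below -/
import Mathlib

section
/- Let A be a Q-division algebra with center a number field K, O a maximal order, 𝔭 a prime of O_K at which A splits with residue field of size q, and φ_𝔭 : O → M_n(F_q) the reduction map, n = √[A:K]. Let ( )* be a positive involution on A_R = A ⊗_Q R and a ∈ A_R symmetric positive definite, with ‖x‖² = Tr(x* a x). If x ∈ O \ {0} is such that φ_𝔭(x) is a non-invertible matrix, then ‖x‖ ≥ √([A:Q]) · N(a)^{1/(2[A:Q])} · q^{1/(n·[K:Q])}. -/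
open scoped NumberField TensorProduct

open Polynomial in
/-- If `f` is annihilated by an irreducible polynomial `p`, its determinant is determined by `p`
and the dimension of the space. -/
theorem LinearMap.det_eq_norm_root_pow {k V : Type*} [Field k] [AddCommGroup V] [Module k V]
    [FiniteDimensional k V] (f : Module.End k V) (p : k[X]) [hp : Fact (Irreducible p)]
    (hf : aeval f p = 0) :
    LinearMap.det f =
      Algebra.norm k (AdjoinRoot.root p) ^ (Module.finrank k V / p.natDegree) := by
  have hker : ∀ g ∈ Ideal.span {p}, (aeval f : k[X] →ₐ[k] Module.End k V).toRingHom g = 0 := by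
    intro g hg
    obtain ⟨c, rfl⟩ := Ideal.mem_span_singleton.mp hg
    simp [hf]
  let ψ : AdjoinRoot p →+* Module.End k V := Ideal.Quotient.lift (Ideal.span {p}) _ hker
  have hψ : ∀ g, ψ (AdjoinRoot.mk p g) = aeval f g := fun g => Ideal.Quotient.lift_mk _ _ _
  let : Module (AdjoinRoot p) V := Module.compHom V ψ
  have hsmul : ∀ (r : AdjoinRoot p) (v : V), r • v = ψ r v := fun _ _ => rfl
  have : IsScalarTower k (AdjoinRoot p) V := by
    refine ⟨fun c r v => ?_⟩
    obtain ⟨g, rfl⟩ := AdjoinRoot.mk_surjective r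
    rw [hsmul, hsmul, AdjoinRoot.smul_mk, hψ, hψ, map_smul, LinearMap.smul_apply]
  have : FiniteDimensional k (AdjoinRoot p) := (AdjoinRoot.powerBasis hp.out.ne_zero).finite
  have : FiniteDimensional (AdjoinRoot p) V := Module.Finite.of_restrictScalars_finite k _ _
  have hfr : f = (LinearMap.lsmul (AdjoinRoot p) V (AdjoinRoot.root p)).restrictScalars k := by
    ext v
    change f v = AdjoinRoot.root p • v
    rw [hsmul, ← AdjoinRoot.mk_X, hψ, aeval_X]
  have hdeg : Module.finrank k (AdjoinRoot p) = p.natDegree := by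
    rw [(AdjoinRoot.powerBasis hp.out.ne_zero).finrank, AdjoinRoot.powerBasis_dim]
  have hdet : LinearMap.det (LinearMap.lsmul (AdjoinRoot p) V (AdjoinRoot.root p)) =
      AdjoinRoot.root p ^ Module.finrank (AdjoinRoot p) V := by
    have : LinearMap.lsmul (AdjoinRoot p) V (AdjoinRoot.root p) =
        AdjoinRoot.root p • LinearMap.id := by ext; simp
    rw [this, LinearMap.det_smul, LinearMap.det_id, mul_one]
  rw [hfr, LinearMap.det_restrictScalars, hdet, map_pow,
    ← Module.finrank_mul_finrank k (AdjoinRoot p) V, hdeg,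
    Nat.mul_div_cancel_left _ hp.out.natDegree_pos]

section DivisionAlgebra

variable {k D : Type*} [Field k] [DivisionRing D] [Algebra k D]

open Polynomial in
theorem LinearMap.aeval_mulLeft (x : D) (g : k[X]) :
    aeval (LinearMap.mulLeft k x) g = LinearMap.mulLeft k (aeval x g) := by
  ext y
  induction g using Polynomial.induction_on' with
  | add p q hp hq => simp_all [add_mul]
  | monomial m c => simp [aeval_monomial, LinearMap.pow_mulLeft, Algebra.smul_def]

open Polynomial in
theorem LinearMap.aeval_mulRight (x : D) (g : k[X]) :
    aeval (LinearMap.mulRight k x) g = LinearMap.mulRight k (aeval x g) := by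
  ext y
  induction g using Polynomial.induction_on' with
  | add p q hp hq => simp_all [mul_add]
  | monomial m c =>
    simp [aeval_monomial, LinearMap.pow_mulRight, ← Algebra.smul_def]

variable [FiniteDimensional k D]

theorem LinearMap.det_mulLeft_eq_norm_root_pow (x : D) :
    LinearMap.det (LinearMap.mulLeft k x) = Algebra.norm k (AdjoinRoot.root (minpoly k x)) ^
      (Module.finrank k D / (minpoly k x).natDegree) := by
  have : Fact (Irreducible (minpoly k x)) :=
    ⟨minpoly.irreducible (Algebra.IsIntegral.isIntegral x)⟩
  exact LinearMap.det_eq_norm_root_pow _ _ (by simp [LinearMap.aeval_mulLeft])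

theorem LinearMap.det_mulRight_eq_det_mulLeft (x : D) :
    LinearMap.det (LinearMap.mulRight k x) = LinearMap.det (LinearMap.mulLeft k x) := by
  have : Fact (Irreducible (minpoly k x)) :=
    ⟨minpoly.irreducible (Algebra.IsIntegral.isIntegral x)⟩
  rw [LinearMap.det_mulLeft_eq_norm_root_pow]
  exact LinearMap.det_eq_norm_root_pow _ _ (by simp [LinearMap.aeval_mulRight])

theorem LinearMap.isIntegral_det_mulLeft {x : D} (hx : IsIntegral ℤ x) :
    IsIntegral ℤ (LinearMap.det (LinearMap.mulLeft k x)) := by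
  have : Fact (Irreducible (minpoly k x)) :=
    ⟨minpoly.irreducible (Algebra.IsIntegral.isIntegral x)⟩
  rw [LinearMap.det_mulLeft_eq_norm_root_pow]
  refine (Algebra.isIntegral_norm k ?_).pow _
  obtain ⟨g, hg, hgx⟩ := hx
  refine ⟨g, hg, ?_⟩
  have hdvd : minpoly k x ∣ g.map (algebraMap ℤ k) := by
    refine minpoly.dvd k x ?_
    rw [Polynomial.aeval_map_algebraMap]
    exact hgx
  have h := AdjoinRoot.mk_eq_zero.mpr hdvd
  rw [← AdjoinRoot.aeval_eq, Polynomial.aeval_map_algebraMap] at h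
  exact h

end DivisionAlgebra

section Trace

open Module

theorem LinearMap.IsSymmetric.det_pos_and_finrank_mul_det_rpow_le_trace {E : Type*}
    [NormedAddCommGroup E] [InnerProductSpace ℝ E] [FiniteDimensional ℝ E] [Nontrivial E]
    {T : E →ₗ[ℝ] E} (hT : T.IsSymmetric) (hpos : ∀ v, v ≠ 0 → 0 < inner ℝ v (T v)) :
    0 < LinearMap.det T ∧
      (finrank ℝ E : ℝ) * LinearMap.det T ^ ((finrank ℝ E : ℝ)⁻¹) ≤ LinearMap.trace ℝ E T := by
  have hμ : ∀ i, 0 < hT.eigenvalues rfl i := fun i => by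
    obtain ⟨v, hv⟩ := (hT.hasEigenvalue_eigenvalues rfl i).exists_hasEigenvector
    have h := hpos v hv.2
    rw [hv.apply_eq_smul, inner_smul_right] at h
    exact pos_of_mul_pos_left h real_inner_self_nonneg
  have hd : (0 : ℝ) < finrank ℝ E := mod_cast finrank_pos
  have key := Real.geom_mean_le_arith_mean Finset.univ (fun _ => (1 : ℝ)) (hT.eigenvalues rfl)
    (fun _ _ => zero_le_one) (by simpa using hd) (fun i _ => (hμ i).le)
  simp only [Real.rpow_one, Finset.sum_const, Finset.card_univ, Fintype.card_fin, one_mul,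
    nsmul_eq_mul, mul_one] at key
  rw [le_div_iff₀' hd] at key
  rw [hT.det_eq_prod_eigenvalues rfl, hT.trace_eq_sum_eigenvalues rfl]
  exact ⟨Finset.prod_pos fun i _ => hμ i, key⟩

/-- The norm-trace inequality for an operator that is symmetric and positive definite with respect
to some positive definite symmetric bilinear form. -/
theorem LinearMap.BilinForm.det_pos_and_finrank_mul_det_rpow_le_trace {V : Type*} [AddCommGroup V]
    [Module ℝ V] [FiniteDimensional ℝ V] [Nontrivial V] (B : LinearMap.BilinForm ℝ V)
    (hsymm : ∀ v w, B v w = B w v) (hB : ∀ v, v ≠ 0 → 0 < B v v)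
    (T : V →ₗ[ℝ] V) (hT : ∀ v w, B (T v) w = B v (T w)) (hpos : ∀ v, v ≠ 0 → 0 < B v (T v)) :
    0 < LinearMap.det T ∧
      (finrank ℝ V : ℝ) * LinearMap.det T ^ ((finrank ℝ V : ℝ)⁻¹) ≤ LinearMap.trace ℝ V T := by
  let c : InnerProductSpace.Core ℝ V :=
    { inner := fun v w => B v w
      conj_inner_symm := fun v w => hsymm w v
      re_inner_nonneg := fun v => by
        rcases eq_or_ne v 0 with rfl | hv
        · simp
        · exact (hB v hv).le
      add_left := fun u v w => by simp
      smul_left := fun u v r => by simp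
      definite := fun v hv => by
        by_contra h
        exact (hB v h).ne' hv }
  let : NormedAddCommGroup V := c.toNormedAddCommGroup
  let : InnerProductSpace ℝ V := InnerProductSpace.ofCore c.toCore
  exact LinearMap.IsSymmetric.det_pos_and_finrank_mul_det_rpow_le_trace (T := T) hT hpos

section StarAlgebra

variable {R : Type*} [Ring R] [Algebra ℝ R] [StarRing R] [StarModule ℝ R]

theorem LinearMap.det_mulLeft_star (x : R) :
    LinearMap.det (LinearMap.mulLeft ℝ (star x)) = LinearMap.det (LinearMap.mulRight ℝ x) := by
  let e : R ≃ₗ[ℝ] R := (starLinearEquiv ℝ : R ≃ₗ⋆[ℝ] R)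
  have he : ∀ y, e y = star y := fun _ => rfl
  have he' : ∀ y, e.symm y = star y := fun _ => rfl
  rw [← LinearMap.det_conj (LinearMap.mulRight ℝ x) e]
  congr 1
  ext y
  simp [he, he']

/-- The norm-trace inequality for a symmetric positive definite element of a real algebra with a
positive involution. -/
theorem LinearMap.det_mulLeft_pos_and_finrank_mul_rpow_le_trace [FiniteDimensional ℝ R]
    [Nontrivial R]
    (hpos : ∀ z : R, z ≠ 0 → 0 < LinearMap.trace ℝ R (LinearMap.mulLeft ℝ (star z * z)))
    (w : R) (hw : star w = w)
    (hwpos : ∀ z : R, z ≠ 0 → 0 < LinearMap.trace ℝ R (LinearMap.mulLeft ℝ (star z * w * z))) :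
    0 < LinearMap.det (LinearMap.mulLeft ℝ w) ∧
      (finrank ℝ R : ℝ) * LinearMap.det (LinearMap.mulLeft ℝ w) ^ ((finrank ℝ R : ℝ)⁻¹) ≤
        LinearMap.trace ℝ R (LinearMap.mulLeft ℝ w) := by
  let t : R →ₗ[ℝ] ℝ := LinearMap.trace ℝ R ∘ₗ LinearMap.mul ℝ R
  have ht : ∀ z, t z = LinearMap.trace ℝ R (LinearMap.mulLeft ℝ z) := fun _ => rfl
  let B₀ : LinearMap.BilinForm ℝ R := LinearMap.mk₂ ℝ (fun y z => t (star y * z))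
    (by simp [add_mul]) (by simp) (by simp [mul_add]) (by simp)
  have hB₀ : ∀ y z, B₀ y z = t (star y * z) := fun _ _ => rfl
  have hflip : ∀ y z, B₀.flip y z = t (star z * y) := fun _ _ => rfl
  refine LinearMap.BilinForm.det_pos_and_finrank_mul_det_rpow_le_trace (B₀ + B₀.flip)
    (fun y z => ?_) (fun z hz => ?_) _ (fun y z => ?_) (fun z hz => ?_)
  · exact add_comm _ _
  · have := hpos z hz
    simpa [hB₀, ht] using this
  · simp only [LinearMap.add_apply, hB₀, hflip, LinearMap.mulLeft_apply, star_mul,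
      hw, mul_assoc]
  · have := hwpos z hz
    simpa only [LinearMap.add_apply, hB₀, hflip, LinearMap.mulLeft_apply, star_mul,
      hw, ← mul_assoc, ht] using add_pos this this

end StarAlgebra

end Trace

/-- If `x` reduces to a singular matrix, then `q ^ n` is at most the absolute norm of `x`. -/
theorem absNorm_pow_le_abs_det_mulLeft {K A : Type*} [Field K] [NumberField K] [DivisionRing A]
    [CharZero A] [Algebra K A] [FiniteDimensional K A] {n : ℕ}
    (hn : Module.finrank K A = n ^ 2) (O : Subring A) (hOfin : Module.Finite ℤ O) (nr : A → K)
    (hnr : ∀ y : A, LinearMap.det (LinearMap.mulLeft K y) = nr y ^ n)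
    (𝔭 : Ideal (𝓞 K)) [𝔭.IsMaximal] (φ : O →+* Matrix (Fin n) (Fin n) ((𝓞 K) ⧸ 𝔭))
    (hφnr : ∀ y : O, ∀ c : 𝓞 K, algebraMap (𝓞 K) K c = nr (y : A) →
      (φ y).det = Ideal.Quotient.mk 𝔭 c)
    (x : O) (hx : (x : A) ≠ 0) (hxinv : ¬ IsUnit (φ x)) :
    (Ideal.absNorm 𝔭 : ℚ) ^ n ≤ |LinearMap.det (LinearMap.mulLeft ℚ (x : A))| := by
  have hn0 : n ≠ 0 := by
    rintro rfl
    have : 0 < Module.finrank K A := Module.finrank_pos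
    omega
  have hxint : IsIntegral ℤ (x : A) :=
    (Algebra.IsIntegral.isIntegral (R := ℤ) x).map (O.subtype.toIntAlgHom)
  have hnrint : IsIntegral ℤ (nr x) := by
    refine IsIntegral.of_pow (Nat.pos_of_ne_zero hn0) ?_
    rw [← hnr]
    exact LinearMap.isIntegral_det_mulLeft hxint
  obtain ⟨c, hc⟩ : ∃ c : 𝓞 K, algebraMap (𝓞 K) K c = nr x := ⟨⟨nr x, hnrint⟩, rfl⟩
  have hc0 : c ≠ 0 := by
    rintro rfl
    have h := hnr x
    rw [← hc, map_zero, zero_pow hn0, LinearMap.det_eq_zero_iff_ker_ne_bot] at h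
    exact h (LinearMap.ker_eq_bot.mpr fun y z hyz => mul_left_cancel₀ hx hyz)
  have hcmem : c ∈ 𝔭 := by
    let _ : Field (𝓞 K ⧸ 𝔭) := Ideal.Quotient.field 𝔭
    rw [← Ideal.Quotient.eq_zero_iff_mem, ← hφnr x c hc]
    by_contra h
    exact hxinv ((Matrix.isUnit_iff_isUnit_det _).mpr (IsUnit.mk0 _ h))
  have hle : Ideal.absNorm 𝔭 ≤ (Algebra.norm ℤ c).natAbs :=
    Nat.le_of_dvd (Int.natAbs_pos.mpr (Algebra.norm_ne_zero_iff.mpr hc0))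
      (Int.natCast_dvd.mp (Ideal.absNorm_dvd_norm_of_mem hcmem))
  have hdet : LinearMap.det (LinearMap.mulLeft ℚ (x : A)) = (Algebra.norm ℤ c : ℚ) ^ n := by
    have h : LinearMap.mulLeft ℚ (x : A) = (LinearMap.mulLeft K (x : A)).restrictScalars ℚ := rfl
    rw [h, LinearMap.det_restrictScalars, hnr, map_pow, ← hc, Algebra.coe_norm_int]
  rw [hdet, abs_pow]
  gcongr
  rw [← Int.cast_abs, Int.abs_eq_natAbs]
  exact_mod_cast hle

theorem LinearMap.det_mulLeft_one_tmul {A : Type*} [DivisionRing A] [CharZero A]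
    [FiniteDimensional ℚ A] (x : A) :
    LinearMap.det (LinearMap.mulLeft ℝ ((1 : ℝ) ⊗ₜ[ℚ] x)) =
      ((LinearMap.det (LinearMap.mulLeft ℚ x) : ℚ) : ℝ) := by
  have h : LinearMap.mulLeft ℝ ((1 : ℝ) ⊗ₜ[ℚ] x) = (LinearMap.mulLeft ℚ x).baseChange ℝ := by
    ext; simp
  rw [h, LinearMap.det_baseChange, eq_ratCast]

theorem LinearMap.det_mulRight_one_tmul {A : Type*} [DivisionRing A] [CharZero A]
    [FiniteDimensional ℚ A] (x : A) :
    LinearMap.det (LinearMap.mulRight ℝ ((1 : ℝ) ⊗ₜ[ℚ] x)) =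
      ((LinearMap.det (LinearMap.mulRight ℚ x) : ℚ) : ℝ) := by
  have h : LinearMap.mulRight ℝ ((1 : ℝ) ⊗ₜ[ℚ] x) = (LinearMap.mulRight ℚ x).baseChange ℝ := by
    ext; simp
  rw [h, LinearMap.det_baseChange, eq_ratCast]

/-- **Lower bound on the norm of points reducing to non-invertible matrices.**
Let `A` be a `ℚ`-division algebra with center a number field `K`, `O` a maximal order,
`𝔭` a prime of `𝓞 K` at which `A` splits with residue field of size `q = N(𝔭)`, and
`φ : O → Mₙ(𝓞 K⧸𝔭)` the reduction map (`n = √[A:K]`), compatible with the reduced norm `nr`.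
Let `star` be a positive involution on `A_ℝ = ℝ ⊗_ℚ A` and `a` symmetric positive definite,
with `‖x‖² = Tr(x* a x)`. If `x ∈ O \ {0}` is such that `φ(x)` is a non-invertible matrix,
then `‖x‖ ≥ √[A:ℚ] · N(a)^(1/(2[A:ℚ])) · q^(1/(n[K:ℚ]))`. -/
theorem stmt5 (K : Type*) [Field K] [NumberField K]
    (A : Type*) [DivisionRing A] [CharZero A] [Algebra K A] [Algebra.IsCentral K A]
    [FiniteDimensional K A] [IsScalarTower ℚ K A]
    (n : ℕ) (hn : Module.finrank K A = n ^ 2)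
    -- `O` is a maximal order in `A`:
    (O : Subring A)
    (hOstab : ∀ c : 𝓞 K, ∀ y ∈ O, algebraMap K A c * y ∈ O)
    (hOfin : Module.Finite ℤ O)
    (hOspan : Submodule.span K (O : Set A) = ⊤)
    (hOmax : ∀ O' : Subring A, (∀ c : 𝓞 K, ∀ y ∈ O', algebraMap K A c * y ∈ O') →
      Module.Finite ℤ O' → Submodule.span K (O' : Set A) = ⊤ → O ≤ O' → O' = O)
    -- the reduced norm, with `N_{A/K} = nr ^ n`:
    (nr : A → K)
    (hnr : ∀ y : A, LinearMap.det (LinearMap.mulLeft K y) = nr y ^ n)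
    -- the prime `𝔭` and reduction map `φ` (split case), compatible with `nr`:
    (𝔭 : Ideal (𝓞 K)) [𝔭.IsMaximal]
    (φ : O →+* Matrix (Fin n) (Fin n) ((𝓞 K) ⧸ 𝔭))
    (hφsurj : Function.Surjective φ)
    (hφnr : ∀ y : O, ∀ c : 𝓞 K, algebraMap (𝓞 K) K c = nr (y : A) →
      (φ y).det = Ideal.Quotient.mk 𝔭 c)
    -- positive involution on `A_ℝ = ℝ ⊗[ℚ] A` and symmetric positive definite `a`:
    [StarRing (ℝ ⊗[ℚ] A)] [StarModule ℝ (ℝ ⊗[ℚ] A)]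
    (hpos : ∀ z : ℝ ⊗[ℚ] A, z ≠ 0 →
      0 < LinearMap.trace ℝ (ℝ ⊗[ℚ] A) (LinearMap.mulLeft ℝ (star z * z)))
    (a : ℝ ⊗[ℚ] A) (ha : star a = a)
    (hapos : ∀ z : ℝ ⊗[ℚ] A, z ≠ 0 →
      0 < LinearMap.trace ℝ (ℝ ⊗[ℚ] A) (LinearMap.mulLeft ℝ (star z * a * z)))
    -- `x ∈ O \ {0}` reduces to a non-invertible matrix:
    (x : O) (hx : (x : A) ≠ 0) (hxinv : ¬ IsUnit (φ x)) :
    Real.sqrt (LinearMap.trace ℝ (ℝ ⊗[ℚ] A) (LinearMap.mulLeft ℝ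
        (star ((1 : ℝ) ⊗ₜ[ℚ] (x : A)) * a * ((1 : ℝ) ⊗ₜ[ℚ] (x : A))))) ≥
      Real.sqrt (Module.finrank ℚ A) *
        (LinearMap.det (LinearMap.mulLeft ℝ a)) ^ (1 / (2 * (Module.finrank ℚ A : ℝ))) *
        (Ideal.absNorm 𝔭 : ℝ) ^ (1 / ((n : ℝ) * (Module.finrank ℚ K : ℝ))) := by
  have : FiniteDimensional ℚ A := FiniteDimensional.trans ℚ K A
  set d := Module.finrank ℚ A with hd
  have hdR : Module.finrank ℝ (ℝ ⊗[ℚ] A) = d := Module.finrank_baseChange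
  have hd_eq : d = Module.finrank ℚ K * n ^ 2 := by rw [← hn, hd, Module.finrank_mul_finrank]
  have hd0 : 0 < d := Module.finrank_pos
  have hn0 : n ≠ 0 := by
    rintro rfl
    rw [hd_eq] at hd0
    simp at hd0
  have hm0 : 0 < Module.finrank ℚ K := Module.finrank_pos
  have : Nontrivial (ℝ ⊗[ℚ] A) := Module.nontrivial_of_finrank_pos (R := ℝ) (hdR ▸ hd0)
  have hN := absNorm_pow_le_abs_det_mulLeft hn O hOfin nr hnr 𝔭 φ hφnr x hx hxinv
  set N := LinearMap.det (LinearMap.mulLeft ℚ (x : A)) with hN_def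
  set X := (1 : ℝ) ⊗ₜ[ℚ] (x : A) with hX_def
  have hX : ∀ z, z ≠ 0 → X * z ≠ 0 := by
    intro z hz h
    apply hz
    have h1 : ((1 : ℝ) ⊗ₜ[ℚ] (x : A)⁻¹) * X = 1 := by
      rw [hX_def, Algebra.TensorProduct.tmul_mul_tmul, inv_mul_cancel₀ hx, one_mul,
        Algebra.TensorProduct.one_def]
    rw [← one_mul z, ← h1, mul_assoc, h, mul_zero]
  have hdeta := (LinearMap.det_mulLeft_pos_and_finrank_mul_rpow_le_trace hpos a ha hapos).1
  have htr := (LinearMap.det_mulLeft_pos_and_finrank_mul_rpow_le_trace hpos (star X * a * X)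
    (by simp [ha, mul_assoc]) (fun z hz => by
      simpa only [star_mul, mul_assoc] using hapos (X * z) (hX z hz))).2
  have hdetW : LinearMap.det (LinearMap.mulLeft ℝ (star X * a * X)) =
      LinearMap.det (LinearMap.mulLeft ℝ a) * (N : ℝ) ^ 2 := by
    rw [LinearMap.mulLeft_mul, LinearMap.mulLeft_mul, LinearMap.det_comp, LinearMap.det_comp,
      LinearMap.det_mulLeft_star, LinearMap.det_mulLeft_one_tmul, LinearMap.det_mulRight_one_tmul,
      LinearMap.det_mulRight_eq_det_mulLeft]
    ring
  rw [hdetW, hdR] at htr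
  set D := LinearMap.det (LinearMap.mulLeft ℝ a)
  set q : ℝ := (Ideal.absNorm 𝔭 : ℝ)
  have hq0 : 0 ≤ q := Nat.cast_nonneg _
  have hNR : (q ^ n) ^ 2 ≤ (N : ℝ) ^ 2 := by
    rw [← sq_abs (N : ℝ)]
    gcongr
    have := Rat.cast_le (K := ℝ).mpr hN
    push_cast at this
    exact this
  refine Real.le_sqrt_of_sq_le 
    (le_trans (b := d * (D * (q ^ n) ^ 2) ^ ((d : ℝ)⁻¹)) (le_of_eq ?_) (le_trans ?_ htr))
  · rw [mul_pow, mul_pow, Real.sq_sqrt (Nat.cast_nonneg _), Real.mul_rpow hdeta.le (by positivity),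
      ← Real.rpow_mul_natCast hdeta.le, ← Real.rpow_mul_natCast hq0, ← pow_mul,
      ← Real.rpow_natCast_mul hq0, mul_assoc]
    have hd0' : (d : ℝ) ≠ 0 := by positivity
    have hn0' : (n : ℝ) ≠ 0 := mod_cast hn0
    have hm0' : (Module.finrank ℚ K : ℝ) ≠ 0 := by positivity
    congr 3
    · push_cast
      field_simp
    · rw [hd_eq]
      push_cast
      field_simp
  · gcongr
end

section
/- Let A_R be a finite-dimensional semisimple R-algebra with positive involution and t ≥ 2. Let Λ ⊂ A_R^t be a lattice stable under left multiplication by an order O (full Z-lattice subring of a Q-division algebra A with A ⊗ R = A_R), with vol(Λ) = 1. Define the j-th A-minimum min_j(Λ) as the smallest r such that the closed ball of radius r contains j left-A_R-linearly independent lattice vectors. Then there exists a lattice Λ' in A_R^t of covolume 1 whose shortest nonzero vector has length (∏_{j=1}^t min_j(Λ))^{1/t}. -/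
/-- Scaling by an antitone family `d` along the Gram–Schmidt basis of a family `e`. -/
theorem exists_gramSchmidt_rescaling {E ι : Type*} [NormedAddCommGroup E] [InnerProductSpace ℝ E]
    [FiniteDimensional ℝ E] [LinearOrder ι] [LocallyFiniteOrderBot ι] [WellFoundedLT ι]
    [Fintype ι] (h : Module.finrank ℝ E = Fintype.card ι) (e : ι → E) (d : ι → ℝ)
    (hd : Antitone d) (hd0 : ∀ i, 0 ≤ d i) :
    ∃ ψ : E →ₗ[ℝ] E, LinearMap.det ψ = ∏ i, d i ∧
      (∀ C, 0 ≤ C → (∀ i, d i ≤ C) → ∀ x, ‖ψ x‖ ≤ C * ‖x‖) ∧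
      ∀ s, 0 ≤ s → ∀ x ∈ Submodule.span ℝ (e '' {i | s ≤ d i}), s * ‖x‖ ≤ ‖ψ x‖ := by
  set f := InnerProductSpace.gramSchmidtOrthonormalBasis h e with hf
  have hnorm : ∀ x, ‖x‖ ^ 2 = ∑ i, f.repr x i ^ 2 := fun x => by
    rw [← f.repr.norm_map x, EuclideanSpace.norm_sq_eq]
    simp
  set ψ := Matrix.toLin f.toBasis f.toBasis (Matrix.diagonal d) with hψ
  have hrepr : ∀ x i, f.repr (ψ x) i = d i * f.repr x i := fun x i => by
    have := congrFun (LinearMap.toMatrix_mulVec_repr f.toBasis f.toBasis ψ x) i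
    rw [hψ, LinearMap.toMatrix_toLin, Matrix.mulVec_diagonal] at this
    simpa using this.symm
  refine ⟨ψ, by rw [hψ, LinearMap.det_toLin, Matrix.det_diagonal], fun C hC hdC x => ?_,
    fun s hs x hx => ?_⟩
  · refine le_of_sq_le_sq ?_ (by positivity)
    rw [mul_pow, hnorm, hnorm, Finset.mul_sum]
    refine Finset.sum_le_sum fun i _ => ?_
    rw [hrepr, mul_pow]
    have := hd0 i
    gcongr
    exact hdC i
  · have hzero : ∀ i, d i < s → f.repr x i = 0 := fun i hi => by
      induction hx using Submodule.span_induction with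
      | mem y hy =>
        obtain ⟨k, hk, rfl⟩ := hy
        refine InnerProductSpace.gramSchmidtOrthonormalBasis_inv_triangular' h e ?_
        by_contra! hik
        exact absurd (hd hik) (not_le.2 (hi.trans_le hk))
      | zero => simp
      | add y z _ _ hy hz => simp [hy, hz]
      | smul r y _ hy => simp [hy]
    refine le_of_sq_le_sq ?_ (norm_nonneg _)
    rw [mul_pow, hnorm, hnorm, Finset.mul_sum]
    refine Finset.sum_le_sum fun i _ => ?_
    rw [hrepr, mul_pow]
    rcases lt_or_ge (d i) s with hi | hi
    · simp [hzero i hi]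
    · gcongr

/-- A nonempty subset of a lattice contains a vector of minimal length. -/
theorem exists_norm_le_of_subset_span_int {E ι : Type*} [NormedAddCommGroup E] [NormedSpace ℝ E]
    [FiniteDimensional ℝ E] [Finite ι] (b : Module.Basis ι ℝ E) {S : Set E} (hS : S.Nonempty)
    (hSb : S ⊆ Submodule.span ℤ (Set.range b)) : ∃ x ∈ S, ∀ y ∈ S, ‖x‖ ≤ ‖y‖ := by
  have : ProperSpace E := FiniteDimensional.proper ℝ E
  obtain ⟨z, hz⟩ := hS
  have hfin : (S ∩ Metric.closedBall 0 ‖z‖).Finite :=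
    (ZSpan.setFinite_inter b (Metric.isBounded_closedBall (x := 0) (r := ‖z‖))).subset
      fun x hx => ⟨hx.2, hSb hx.1⟩
  obtain ⟨x, hx, hmin⟩ := Set.exists_min_image _ norm hfin ⟨z, hz, by simp⟩
  refine ⟨x, hx.1, fun y hy => ?_⟩
  rcases le_total ‖y‖ ‖z‖ with h | h
  · exact hmin y ⟨hy, by simpa using h⟩
  · exact (by simpa using hx.2 : ‖x‖ ≤ ‖z‖).trans h

/-- A sequence obtained by successively choosing shortest vectors of `S` outside the span of the
previous ones, as long as there are any. -/
theorem exists_seq_forall_norm_le {R E ι : Type*} [Ring R] [NormedAddCommGroup E]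
    [NormedSpace ℝ E] [FiniteDimensional ℝ E] [Finite ι] [Module R E] (b : Module.Basis ι ℝ E)
    {S : Set E} (hSb : S ⊆ Submodule.span ℤ (Set.range b)) :
    ∃ v : ℕ → E, ∀ j, ¬ S ⊆ Submodule.span R (v '' Set.Iio j) →
      v j ∈ S ∧ v j ∉ Submodule.span R (v '' Set.Iio j) ∧
        ∀ y ∈ S, y ∉ Submodule.span R (v '' Set.Iio j) → ‖v j‖ ≤ ‖y‖ := by
  have hex : ∀ T : Set E, ∃ x, ¬ S ⊆ Submodule.span R T →
      x ∈ S ∧ x ∉ Submodule.span R T ∧ ∀ y ∈ S, y ∉ Submodule.span R T → ‖x‖ ≤ ‖y‖ := by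
    intro T
    by_cases hT : S ⊆ Submodule.span R T
    · exact ⟨0, fun h => absurd hT h⟩
    · obtain ⟨x, hx, hmin⟩ := exists_norm_le_of_subset_span_int b
        (S := S \ Submodule.span R T) (Set.sdiff_nonempty.2 hT) (Set.sdiff_subset.trans hSb)
      exact ⟨x, fun _ => ⟨hx.1, hx.2, fun y hy hy' => hmin y ⟨hy, hy'⟩⟩⟩
  choose g hg using hex
  let L : ℕ → Set E := fun k => Nat.rec ∅ (fun _ T => insert (g T) T) k
  have hL : ∀ k, L k = (fun k => g (L k)) '' Set.Iio k := by
    intro k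
    induction k with
    | zero => simp [L]
    | succ k ih =>
      have : Set.Iio (k + 1) = insert k (Set.Iio k) := by
        ext m; simp only [Set.mem_Iio, Set.mem_insert_iff]; omega
      rw [this, Set.image_insert_eq, ← ih]
  refine ⟨fun k => g (L k), fun j => ?_⟩
  rw [← hL j]
  exact hg (L j)

theorem divNat_finProdFinEquiv {m n : ℕ} (j : Fin m) (k : Fin n) :
    (finProdFinEquiv (j, k)).divNat = j :=
  congrArg Prod.fst (finProdFinEquiv.symm_apply_apply (j, k))

theorem modNat_finProdFinEquiv {m n : ℕ} (j : Fin m) (k : Fin n) :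
    (finProdFinEquiv (j, k)).modNat = k :=
  congrArg Prod.snd (finProdFinEquiv.symm_apply_apply (j, k))

/-- Rescaling the Gram–Schmidt components of a sequence of successively shortest vectors of `S`
gives a map of determinant one under which the shortest image of a nonzero vector of `S` has as
length the geometric mean of the lengths of the sequence. -/
theorem exists_det_eq_one_and_isLeast {R E : Type*} [Ring R] [Algebra ℝ R]
    [FiniteDimensional ℝ R] [NormedAddCommGroup E] [InnerProductSpace ℝ E]
    [FiniteDimensional ℝ E] [Module R E] [IsScalarTower ℝ R E] {t : ℕ} (ht : 0 < t)
    (hE : Module.finrank ℝ E = t * Module.finrank ℝ R) {S : Set E} {v : ℕ → E}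
    (hspan : Submodule.span R (v '' Set.Iio t) = ⊤) (hv0 : ∀ j < t, v j ≠ 0)
    (hvS : v 0 ∈ S) (hmono : ∀ i j, i ≤ j → j < t → ‖v i‖ ≤ ‖v j‖)
    (hmin : ∀ j < t, ∀ x ∈ S, x ∉ Submodule.span R (v '' Set.Iio j) → ‖v j‖ ≤ ‖x‖)
    {c : ℝ} (hc : 0 ≤ c) (hct : c ^ t = ∏ j ∈ Finset.range t, ‖v j‖) :
    ∃ ψ : E →ₗ[ℝ] E, LinearMap.det ψ = 1 ∧
      IsLeast {s | ∃ x ∈ S, x ≠ 0 ∧ ‖ψ x‖ = s} c := by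
  set n := Module.finrank ℝ R
  let ε := Module.finBasis ℝ R
  let e : Fin (t * n) → E := fun k => ε k.modNat • v k.divNat
  let d : Fin (t * n) → ℝ := fun k => c / ‖v k.divNat‖
  have hpos : ∀ j < t, 0 < ‖v j‖ := fun j hj => norm_pos_iff.2 (hv0 j hj)
  have hdiv : Monotone (Fin.divNat : Fin (t * n) → Fin t) := fun k l hkl =>
    Nat.div_le_div_right (c := n) hkl
  have hd : Antitone d := fun k l hkl =>
    div_le_div_of_nonneg_left hc (hpos _ k.divNat.2) (hmono _ _ (hdiv hkl) l.divNat.2)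
  obtain ⟨ψ, hdet, hup, hlow⟩ := exists_gramSchmidt_rescaling (by simpa using hE) e d hd
    (fun k => by positivity)
  have hlower : ∀ x ∈ S, x ≠ 0 → c ≤ ‖ψ x‖ := by
    intro x hx hx0
    have hex : ∃ j, x ∈ Submodule.span R (v '' Set.Iio j) := ⟨t, by simp [hspan]⟩
    classical
    obtain ⟨j, hj⟩ : ∃ j, Nat.find hex = j + 1 := by
      refine Nat.exists_eq_succ_of_ne_zero fun h0 => hx0 ?_
      have := Nat.find_spec hex
      rw [h0] at this
      simpa using this
    have hjt : j < t := by
      have : Nat.find hex ≤ t := Nat.find_min' hex (by simp [hspan])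
      omega
    have hvx : ‖v j‖ ≤ ‖x‖ := hmin j hjt x hx (Nat.find_min hex (by omega))
    have hxj : x ∈ Submodule.span R (v '' Set.Iio (j + 1)) := hj ▸ Nat.find_spec hex
    have hsub : ∀ y ∈ Submodule.span R (v '' Set.Iio (j + 1)),
        y ∈ Submodule.span ℝ (e '' {k | c / ‖v j‖ ≤ d k}) := by
      intro y hy
      suffices h : ∀ r : R, r • y ∈ Submodule.span ℝ (e '' {k | c / ‖v j‖ ≤ d k}) by
        simpa using h 1
      induction hy using Submodule.span_induction with
      | mem z hz =>
        obtain ⟨i, hi, rfl⟩ := hz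
        have hij : i ≤ j := Nat.lt_succ_iff.1 hi
        intro r
        rw [← ε.sum_repr r, Finset.sum_smul]
        refine Submodule.sum_mem _ fun k _ => ?_
        rw [smul_assoc]
        refine Submodule.smul_mem _ _ (Submodule.subset_span
          ⟨finProdFinEquiv (⟨i, hij.trans_lt hjt⟩, k), ?_, ?_⟩)
        · simp only [d, Set.mem_ofPred_eq, divNat_finProdFinEquiv]
          exact div_le_div_of_nonneg_left hc (hpos _ (hij.trans_lt hjt)) (hmono _ _ hij hjt)
        · simp only [e, divNat_finProdFinEquiv, modNat_finProdFinEquiv]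
      | zero => simp
      | add y z _ _ hy hz => exact fun r => by simpa using add_mem (hy r) (hz r)
      | smul q y _ hy => exact fun r => by simpa [mul_smul] using hy (r * q)
    calc c = c / ‖v j‖ * ‖v j‖ := (div_mul_cancel₀ _ (hpos j hjt).ne').symm
      _ ≤ c / ‖v j‖ * ‖x‖ := by gcongr
      _ ≤ ‖ψ x‖ := hlow _ (by positivity) x (hsub x hxj)
  refine ⟨ψ, ?_, ⟨v 0, hvS, hv0 0 ht, le_antisymm ?_ (hlower _ hvS (hv0 0 ht))⟩, ?_⟩
  · rw [hdet, ← finProdFinEquiv.prod_comp, Fintype.prod_prod_type]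
    have : ∏ j : Fin t, (c / ‖v j‖) = 1 := by
      rw [Finset.prod_div_distrib, Finset.prod_const, Finset.card_univ, Fintype.card_fin, hct,
        ← Fin.prod_univ_eq_prod_range (fun j => ‖v j‖) t]
      exact div_self (Finset.prod_ne_zero_iff.2 fun j _ => (hpos j j.2).ne')
    simp only [d, divNat_finProdFinEquiv, Finset.prod_const, Finset.prod_pow, this, one_pow]
  · calc ‖ψ (v 0)‖ ≤ c / ‖v 0‖ * ‖v 0‖ := hup _ (by positivity)
          (fun k => div_le_div_of_nonneg_left hc (hpos 0 ht)
          (hmono _ _ (Nat.zero_le _) k.divNat.2)) _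
      _ = c := div_mul_cancel₀ _ (hpos 0 ht).ne'
  · rintro _ ⟨x, hx, hx0, rfl⟩
    exact hlower x hx hx0

/-- Vectors each lying outside the span of the previous ones are linearly independent. -/
theorem linearIndependent_of_forall_notMem_span_Iio {K V : Type*} [DivisionRing K]
    [AddCommGroup V] [Module K V] {t : ℕ} {v : ℕ → V}
    (hv : ∀ j < t, v j ∉ Submodule.span K (v '' Set.Iio j)) :
    LinearIndependent K fun j : Fin t => v j := by
  induction t with
  | zero => exact linearIndependent_empty_type
  | succ t ih =>
    rw [linearIndependent_finSucc']
    refine ⟨ih fun j hj => hv j (by omega), fun h => hv t (by omega) ?_⟩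
    refine Submodule.span_mono ?_ h
    rintro _ ⟨j, rfl⟩
    exact ⟨j, j.2, rfl⟩

/-- A division algebra spanning a real algebra has at least the same dimension. -/
theorem finrank_le_finrank_of_span_range_eq_top {R A : Type*} [Ring R] [Algebra ℝ R]
    [DivisionRing A] [CharZero A] [FiniteDimensional ℚ A] (i : A →+* R)
    (hi : Submodule.span ℝ (Set.range i) = ⊤) : Module.finrank ℝ R ≤ Module.finrank ℚ A := by
  let : Module ℚ R := Module.compHom R (algebraMap ℚ ℝ)
  let β := Module.finBasis ℚ A
  have hspan : Submodule.span ℝ (Set.range (i ∘ β)) = ⊤ := by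
    rw [eq_top_iff, ← hi, Submodule.span_le]
    rintro _ ⟨x, rfl⟩
    rw [← β.sum_repr x, map_sum]
    refine Submodule.sum_mem _ fun k _ => ?_
    rw [map_rat_smul i]
    exact Submodule.smul_mem _ ((β.repr x k : ℚ) : ℝ) (Submodule.subset_span ⟨k, rfl⟩)
  simpa using finrank_le_of_span_eq_top hspan

/-- In a lattice stable under an order of a division algebra `A`, vectors lying successively
outside the `A ⊗ ℝ`-span of the previous ones span the whole space once there are `t` of them. -/
theorem span_eq_top_of_forall_notMem_span_Iio {R A E : Type*} [Ring R] [Algebra ℝ R]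
    [FiniteDimensional ℝ R] [DivisionRing A] [CharZero A] [FiniteDimensional ℚ A] (i : A →+* R)
    (hi : Submodule.span ℝ (Set.range i) = ⊤) (O : Subring A)
    (hO : Submodule.span ℚ (O : Set A) = ⊤) [AddCommGroup E] [Module ℝ E] [Module R E]
    [IsScalarTower ℝ R E] {t : ℕ} (b : Fin (t * Module.finrank ℝ R) → E)
    (hb : Submodule.span ℝ (Set.range b) = ⊤)
    (hOb : ∀ r ∈ O, ∀ x ∈ Submodule.span ℤ (Set.range b),
      i r • x ∈ Submodule.span ℤ (Set.range b)) {v : ℕ → E}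
    (hvb : ∀ j < t, v j ∈ Submodule.span ℤ (Set.range b))
    (hv : ∀ j < t, v j ∉ Submodule.span R (v '' Set.Iio j)) :
    Submodule.span R (v '' Set.Iio t) = ⊤ := by
  let : Module ℚ E := Module.compHom E (algebraMap ℚ ℝ)
  let : Module A E := Module.compHom E i
  have hAR : ∀ T : Set E, ∀ x ∈ Submodule.span A T, x ∈ Submodule.span R T := by
    intro T x hx
    induction hx using Submodule.span_induction with
    | mem y hy => exact Submodule.subset_span hy
    | zero => exact zero_mem _
    | add y z _ _ hy hz => exact add_mem hy hz
    | smul r y _ hy => exact Submodule.smul_mem _ (i r) hy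
  have hint : ∀ x ∈ Submodule.span ℤ (Set.range b), x ∈ Submodule.span ℚ (Set.range b) :=
    fun x hx => Submodule.span_le_restrictScalars ℤ ℚ _ hx
  have hbstab : ∀ (r : A) (k), r • b k ∈ Submodule.span ℚ (Set.range b) := by
    intro r k
    have hr : r ∈ Submodule.span ℚ (O : Set A) := hO ▸ Submodule.mem_top
    induction hr using Submodule.span_induction with
    | mem y hy => exact hint _ (hOb y hy _ (Submodule.subset_span ⟨k, rfl⟩))
    | zero => simp
    | add y z _ _ hy hz => simpa [add_smul] using add_mem hy hz
    | smul q y _ hy => simpa [smul_assoc] using Submodule.smul_mem _ q hy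
  have hstab : ∀ (r : A), ∀ x ∈ Submodule.span ℚ (Set.range b),
      r • x ∈ Submodule.span ℚ (Set.range b) := by
    intro r x hx
    induction hx using Submodule.span_induction with
    | mem y hy => obtain ⟨k, rfl⟩ := hy; exact hbstab r k
    | zero => simp
    | add y z _ _ hy hz => simpa using add_mem hy hz
    | smul q y _ hy =>
      rw [smul_comm]
      exact Submodule.smul_mem _ q hy
  let M : Submodule A E :=
    { (Submodule.span ℚ (Set.range b)).toAddSubmonoid with smul_mem' := fun r x hx => hstab r x hx }
  have hvA : LinearIndependent A fun j : Fin t => v j :=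
    linearIndependent_of_forall_notMem_span_Iio fun j hj h => hv j hj (hAR _ _ h)
  have hrange : Set.range (fun j : Fin t => v j) = v '' Set.Iio t := by
    ext x
    constructor
    · rintro ⟨j, rfl⟩; exact ⟨j, j.2, rfl⟩
    · rintro ⟨j, hj, rfl⟩; exact ⟨⟨j, hj⟩, rfl⟩
  have hle : (Submodule.span A (v '' Set.Iio t)).restrictScalars ℚ ≤
      Submodule.span ℚ (Set.range b) := by
    intro x hx
    have : Submodule.span A (v '' Set.Iio t) ≤ M := by
      rw [Submodule.span_le]
      rintro _ ⟨j, hj, rfl⟩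
      exact hint _ (hvb j hj)
    exact this hx
  have hfin : Module.finrank ℚ (Submodule.span ℚ (Set.range b)) ≤
      Module.finrank ℚ ((Submodule.span A (v '' Set.Iio t)).restrictScalars ℚ) := by
    have h1 : Module.finrank ℚ A * Module.finrank A (Submodule.span A (v '' Set.Iio t)) =
      Module.finrank ℚ ((Submodule.span A (v '' Set.Iio t)).restrictScalars ℚ) :=
      Module.finrank_mul_finrank ℚ A (Submodule.span A (v '' Set.Iio t))
    rw [← h1, ← hrange, finrank_span_eq_card hvA, Fintype.card_fin]
    calc _ ≤ t * Module.finrank ℝ R :=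
        (finrank_range_le_card (R := ℚ) b).trans_eq (Fintype.card_fin _)
      _ ≤ _ := by
        rw [mul_comm]
        exact Nat.mul_le_mul_right _ (finrank_le_finrank_of_span_range_eq_top i hi)
  have hfd : FiniteDimensional ℚ (Submodule.span ℚ (Set.range b)) :=
    FiniteDimensional.span_of_finite ℚ (Set.finite_range b)
  have heq := Submodule.eq_of_le_of_finrank_le hle hfin
  have hbmem : Set.range b ⊆ (Submodule.span R (v '' Set.Iio t)).restrictScalars ℝ := by
    intro x hx
    have : x ∈ (Submodule.span A (v '' Set.Iio t)).restrictScalars ℚ :=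
      heq ▸ Submodule.subset_span hx
    exact hAR _ _ this
  have := Submodule.span_le.2 hbmem
  rw [hb, top_le_iff] at this
  exact (Submodule.restrictScalars_eq_top_iff ℝ R E).1 this

/-- Positivity of `x ↦ tr (x* x)` makes the trace form invariant under the involution. -/
theorem trace_mulLeft_star {R : Type*} [Ring R] [Algebra ℝ R] [FiniteDimensional ℝ R] [StarRing R]
    [StarModule ℝ R]
    (hpos : ∀ z : R, z ≠ 0 → 0 < LinearMap.trace ℝ R (LinearMap.mulLeft ℝ (star z * z))) (z : R) :
    LinearMap.trace ℝ R (LinearMap.mulLeft ℝ (star z)) =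
      LinearMap.trace ℝ R (LinearMap.mulLeft ℝ z) := by
  let T : R →ₗ[ℝ] ℝ := LinearMap.trace ℝ R ∘ₗ LinearMap.mul ℝ R
  let F : R →ₗ[ℝ] Module.Dual ℝ R :=
    { toFun := fun x => T ∘ₗ LinearMap.mulLeft ℝ (star x)
      map_add' := fun x y => by ext w; simp [add_mul]
      map_smul' := fun r x => by ext w; simp }
  have hinj : Function.Injective F := by
    rw [injective_iff_map_eq_zero]
    intro x hx
    by_contra hx0
    exact (hpos x hx0).ne' (LinearMap.congr_fun hx x)
  let e : R ≃ₗ[ℝ] Module.Dual ℝ R :=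
    LinearEquiv.ofInjectiveOfFinrankEq F hinj (by rw [Subspace.dual_finrank_eq])
  have he : e.conj (LinearMap.mulLeft ℝ z) =
      Module.Dual.transpose (LinearMap.mulLeft ℝ (star z)) := by
    ext f w
    obtain ⟨x, rfl⟩ := e.surjective f
    rw [LinearEquiv.conj_apply_apply, e.symm_apply_apply]
    change T (star (z * x) * w) = T (star x * (star z * w))
    rw [star_mul, mul_assoc]
  rw [← LinearMap.trace_transpose', ← he, LinearMap.trace_conj']

/-- Minkowski's lemma in a Euclidean space with an action of `R = A ⊗ ℝ`: the lattice spanned by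
`b` has an image of the same covolume whose shortest vector has as length the geometric mean of
the successive minima. -/
theorem exists_det_eq_one_and_isLeast_prod_minima {R A E : Type*} [Ring R] [Algebra ℝ R]
    [FiniteDimensional ℝ R] [StrongRankCondition R] [OrzechProperty R] [DivisionRing A]
    [CharZero A] [FiniteDimensional ℚ A] (i : A →+* R)
    (hi : Submodule.span ℝ (Set.range i) = ⊤) (O : Subring A)
    (hO : Submodule.span ℚ (O : Set A) = ⊤) [NormedAddCommGroup E] [InnerProductSpace ℝ E]
    [FiniteDimensional ℝ E] [Module R E] [IsScalarTower ℝ R E] {t : ℕ} (ht : 0 < t)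
    (p : Module.Basis (Fin t) R E) (b : Module.Basis (Fin (t * Module.finrank ℝ R)) ℝ E)
    (hOb : ∀ r ∈ O, ∀ x ∈ Submodule.span ℤ (Set.range b),
      i r • x ∈ Submodule.span ℤ (Set.range b))
    (minJ : ℕ → ℝ)
    (hminJ : ∀ m : ℕ, minJ m = sInf {s : ℝ | 0 ≤ s ∧ ∃ w : Fin m → E,
      (∀ l, w l ∈ Submodule.span ℤ (Set.range b)) ∧ LinearIndependent R w ∧ ∀ l, ‖w l‖ ≤ s}) :
    ∃ ψ : E →ₗ[ℝ] E, LinearMap.det ψ = 1 ∧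
      IsLeast {s | ∃ x ∈ Submodule.span ℤ (Set.range b), x ≠ 0 ∧ ‖ψ x‖ = s}
        ((∏ j ∈ Finset.range t, minJ (j + 1)) ^ (1 / (t : ℝ))) := by
  obtain ⟨v, hv⟩ := exists_seq_forall_norm_le (R := R) b
    (S := Submodule.span ℤ (Set.range b)) subset_rfl
  have hcard : ∀ j m, ∀ w : Fin m → E, LinearIndependent R w →
      Set.range w ⊆ Submodule.span R (v '' Set.Iio j) → m ≤ j := by
    classical
    intro j m w hw hsub
    rw [show v '' Set.Iio j = ((Finset.range j).image v : Finset E) by simp] at hsub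
    have := linearIndependent_le_span' w hw _ hsub
    rw [Cardinal.mk_fin, Nat.cast_le, ← Set.toFinset_card,
      Finset.toFinset_coe] at this
    exact this.trans (Finset.card_image_le.trans (Finset.card_range j).le)
  have hnot : ∀ j < t,
      ¬ (Submodule.span ℤ (Set.range b) : Set E) ⊆ Submodule.span R (v '' Set.Iio j) := by
    intro j hj hsub
    have htop : Submodule.span ℝ (Set.range b) ≤
        (Submodule.span R (v '' Set.Iio j)).restrictScalars ℝ :=
      Submodule.span_le.2 (Submodule.subset_span.trans hsub)
    rw [b.span_eq] at htop
    exact absurd (hcard j t p p.linearIndependent fun x _ => htop Submodule.mem_top) (by omega)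
  have hmem := fun j hj => (hv j (hnot j hj)).1
  have hout := fun j hj => (hv j (hnot j hj)).2.1
  have hmin := fun j hj => (hv j (hnot j hj)).2.2
  have hspan := span_eq_top_of_forall_notMem_span_Iio i hi O hO b b.span_eq hOb hmem hout
  have hmono : ∀ k j, k ≤ j → j < t → ‖v k‖ ≤ ‖v j‖ := fun k j hkj hj =>
    hmin k (hkj.trans_lt hj) _ (hmem j hj) fun h => hout j hj
      (Submodule.span_mono (Set.image_mono (Set.Iio_subset_Iio hkj)) h)
  have hrange : Set.range (fun j : Fin t => v j) = v '' Set.Iio t := by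
    ext x
    constructor
    · rintro ⟨j, rfl⟩; exact ⟨j, j.2, rfl⟩
    · rintro ⟨j, hj, rfl⟩; exact ⟨⟨j, hj⟩, rfl⟩
  have hli : LinearIndependent R fun j : Fin t => v j :=
    linearIndependent_of_top_le_span_of_card_eq_finrank (by rw [hrange, hspan])
      (Module.finrank_eq_card_basis p).symm
  have hminima : ∀ j < t, minJ (j + 1) = ‖v j‖ := by
    intro j hj
    rw [hminJ]
    refine IsLeast.csInf_eq ⟨⟨norm_nonneg _, fun l => v l, fun l => hmem l (by omega),
      hli.comp (Fin.castLE hj) (Fin.castLE_injective _), fun l => hmono _ _ (by omega) hj⟩, ?_⟩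
    rintro s ⟨-, w, hwmem, hwli, hws⟩
    by_contra! hs
    refine absurd (hcard j (j + 1) w hwli ?_) (by omega)
    rintro _ ⟨l, rfl⟩
    by_contra h
    exact absurd (hmin j hj _ (hwmem l) h) (not_le.2 ((hws l).trans_lt hs))
  have hprod : ∏ j ∈ Finset.range t, minJ (j + 1) = ∏ j ∈ Finset.range t, ‖v j‖ :=
    Finset.prod_congr rfl fun j hj => hminima j (Finset.mem_range.1 hj)
  have hprod0 : 0 ≤ ∏ j ∈ Finset.range t, ‖v j‖ := Finset.prod_nonneg fun _ _ => norm_nonneg _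
  rw [hprod, one_div]
  exact exists_det_eq_one_and_isLeast (R := R) ht
    ((Module.finrank_eq_card_basis b).trans (Fintype.card_fin _)) hspan
    (fun j hj h => hout j hj (h ▸ zero_mem _)) (hmem 0 ht) hmono hmin (by positivity)
    (Real.rpow_inv_natCast_pow hprod0 ht.ne')

theorem linearIndependent_of_det_bilinForm_ne_zero {V ι : Type*} [AddCommGroup V] [Module ℝ V]
    [Fintype ι] [DecidableEq ι] (F : LinearMap.BilinForm ℝ V) (b : ι → V)
    (h : (Matrix.of fun k l => F (b k) (b l)).det ≠ 0) : LinearIndependent ℝ b := by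
  rw [Fintype.linearIndependent_iff]
  intro g hg
  refine congrFun (Matrix.eq_zero_of_mulVec_eq_zero h (funext fun k => ?_))
  calc _ = F (b k) (∑ l, g l • b l) := by simp [Matrix.mulVec, dotProduct, mul_comm]
    _ = 0 := by rw [hg, map_zero]

theorem det_bilinForm_map {V ι : Type*} [AddCommGroup V] [Module ℝ V]
    [Fintype ι] [DecidableEq ι] (F : LinearMap.BilinForm ℝ V) (b : Module.Basis ι ℝ V)
    (ψ : V →ₗ[ℝ] V) :
    (Matrix.of fun k l => F (ψ (b k)) (ψ (b l))).det =
      LinearMap.det ψ ^ 2 * (Matrix.of fun k l => F (b k) (b l)).det := by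
  have h := congrArg Matrix.det (LinearMap.BilinForm.toMatrix_comp b b F ψ ψ)
  rw [Matrix.det_mul, Matrix.det_mul, Matrix.det_transpose, LinearMap.det_toMatrix] at h
  calc _ = (LinearMap.BilinForm.toMatrix b (F.comp ψ ψ)).det := by
        congr 1; ext k l; simp [LinearMap.BilinForm.toMatrix_apply]
    _ = _ := by
        rw [h, show LinearMap.BilinForm.toMatrix b F = Matrix.of fun k l => F (b k) (b l) by
          ext k l; simp [LinearMap.BilinForm.toMatrix_apply]]
        ring

open Finset in
/-- **Minkowski's lemma for `O`-lattices (after Vance).**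
Let `A_ℝ` be a finite-dimensional semisimple `ℝ`-algebra with positive involution and
`t ≥ 2`. Let `Λ ⊂ A_ℝ^t` be a lattice (full `ℤ`-lattice, of covolume one with respect to the
Euclidean structure `B(x,y) = Σⱼ Tr(xⱼ* a yⱼ)`) stable under left multiplication by an order
`O` in a `ℚ`-division algebra `A` with `A ⊗ ℝ = A_ℝ`. Let `min_j(Λ)` be the `j`-th
`A`-minimum of `Λ`. Then there exists a lattice `Λ'` in `A_ℝ^t` of covolume one whose
shortest nonzero vector has length `(∏_{j=1}^t min_j(Λ))^{1/t}`. -/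
theorem stmt13
    -- the semisimple `ℝ`-algebra `A_ℝ` with positive involution:
    (AR : Type*) [Ring AR] [Algebra ℝ AR] [FiniteDimensional ℝ AR] [IsSemisimpleRing AR]
    [StarRing AR] [StarModule ℝ AR]
    (hpos : ∀ z : AR, z ≠ 0 → 0 < LinearMap.trace ℝ AR (LinearMap.mulLeft ℝ (star z * z)))
    (a : AR) (ha : star a = a)
    (hapos : ∀ z : AR, z ≠ 0 → 0 < LinearMap.trace ℝ AR (LinearMap.mulLeft ℝ (star z * a * z)))
    -- the `ℚ`-division algebra `A` with `A ⊗ ℝ = A_ℝ`, via the embedding `i`: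
    (A : Type*) [DivisionRing A] [CharZero A] [FiniteDimensional ℚ A]
    (i : A →+* AR) (hi : Function.Injective i)
    (hispan : Submodule.span ℝ (Set.range i) = ⊤)
    -- an order `O` in `A`:
    (O : Subring A) (hOfin : Module.Finite ℤ O)
    (hOspan : Submodule.span ℚ (O : Set A) = ⊤)
    (t : ℕ) (ht : 2 ≤ t)
    -- the Euclidean structure on `A_ℝ^t`:
    (B : (Fin t → AR) → (Fin t → AR) → ℝ)
    (hB : ∀ x y, B x y = ∑ j, LinearMap.trace ℝ AR (LinearMap.mulLeft ℝ (star (x j) * a * y j)))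
    -- the lattice `Λ`, an `O`-module, of covolume one (Gram determinant one):
    (Λ : Submodule ℤ (Fin t → AR))
    (hΛO : ∀ r ∈ O, ∀ x ∈ Λ, (fun j => i r * x j) ∈ Λ)
    (b : Fin (t * Module.finrank ℝ AR) → (Fin t → AR))
    (hb : LinearIndependent ℤ b) (hbspan : Submodule.span ℤ (Set.range b) = Λ)
    (hvol : (Matrix.of fun k l => B (b k) (b l)).det = 1)
    -- the successive `A`-minima of `Λ`:
    (minJ : ℕ → ℝ)
    (hminJ : ∀ m : ℕ, minJ m = sInf {s : ℝ | 0 ≤ s ∧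
      ∃ v : Fin m → (Fin t → AR), (∀ l, v l ∈ Λ) ∧ LinearIndependent AR v ∧
        ∀ l, Real.sqrt (B (v l) (v l)) ≤ s}) :
    ∃ (Λ' : Submodule ℤ (Fin t → AR)) (b' : Fin (t * Module.finrank ℝ AR) → (Fin t → AR)),
      LinearIndependent ℤ b' ∧ Submodule.span ℤ (Set.range b') = Λ' ∧
      (Matrix.of fun k l => B (b' k) (b' l)).det = 1 ∧
      IsLeast {s : ℝ | ∃ y ∈ Λ', y ≠ 0 ∧ Real.sqrt (B y y) = s}
        ((∏ j ∈ Finset.range t, minJ (j + 1)) ^ (1 / (t : ℝ))) := by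
  have ht0 : 0 < t := by omega
  have : Nontrivial AR := hi.nontrivial
  have htr := trace_mulLeft_star hpos
  obtain ⟨T, hT⟩ : ∃ T : AR →ₗ[ℝ] ℝ,
      ∀ z, LinearMap.trace ℝ AR (LinearMap.mulLeft ℝ z) = T z :=
    ⟨LinearMap.trace ℝ AR ∘ₗ LinearMap.mul ℝ AR, fun _ => rfl⟩
  have hBT : ∀ x y, B x y = ∑ j, T (star (x j) * a * y j) := fun x y => by simp only [hB, hT]
  let F : LinearMap.BilinForm ℝ (Fin t → AR) := LinearMap.mk₂ ℝ B
    (fun x y z => by simp [hBT, add_mul, Finset.sum_add_distrib])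
    (fun r x y => by simp [hBT, Finset.mul_sum])
    (fun x y z => by simp [hBT, mul_add, Finset.sum_add_distrib])
    (fun r x y => by simp [hBT, Finset.mul_sum])
  have hsymm : ∀ x y, B y x = B x y := fun x y => by
    rw [hB, hB]
    refine Finset.sum_congr rfl fun j _ => ?_
    rw [← htr (star (x j) * a * y j), star_mul, star_mul, star_star, ha, mul_assoc]
  have hnonneg : ∀ z, 0 ≤ LinearMap.trace ℝ AR (LinearMap.mulLeft ℝ (star z * a * z)) := by
    intro z
    rcases eq_or_ne z 0 with rfl | hz
    · simp
    · exact (hapos z hz).le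
  let core : InnerProductSpace.Core ℝ (Fin t → AR) :=
    { inner := B
      conj_inner_symm := fun x y => hsymm x y
      re_inner_nonneg := fun x => by
        simpa [hB] using Finset.sum_nonneg fun j _ => hnonneg (x j)
      add_left := fun x y z => LinearMap.map_add₂ F x y z
      smul_left := fun x y r => LinearMap.map_smul₂ F r x y
      definite := fun x hx => by
        have hx' : B x x = 0 := hx
        rw [hB, Finset.sum_eq_zero_iff_of_nonneg fun j _ => hnonneg (x j)] at hx'
        ext j
        by_contra hj
        exact (hapos _ hj).ne' (hx' j (Finset.mem_univ j)) }
  have hbR : LinearIndependent ℝ b :=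
    linearIndependent_of_det_bilinForm_ne_zero F b (hvol.trans_ne one_ne_zero)
  let b₀ : Module.Basis (Fin (t * Module.finrank ℝ AR)) ℝ (Fin t → AR) :=
    haveI : Nonempty (Fin (t * Module.finrank ℝ AR)) :=
      ⟨⟨0, Nat.mul_pos ht0 Module.finrank_pos⟩⟩
    basisOfLinearIndependentOfCardEqFinrank hbR (by simp [Module.finrank_pi_fintype])
  have hb₀ : ⇑b₀ = b := by simp [b₀]
  let p := Pi.basisFun AR (Fin t)
  obtain ⟨ψ, hdet, hleast⟩ : ∃ ψ : (Fin t → AR) →ₗ[ℝ] (Fin t → AR), LinearMap.det ψ = 1 ∧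
      IsLeast {s | ∃ x ∈ Submodule.span ℤ (Set.range b₀), x ≠ 0 ∧
        Real.sqrt (B (ψ x) (ψ x)) = s}
        ((∏ j ∈ Finset.range t, minJ (j + 1)) ^ (1 / (t : ℝ))) := by
    let : NormedAddCommGroup (Fin t → AR) := core.toNormedAddCommGroup
    let : InnerProductSpace ℝ (Fin t → AR) := InnerProductSpace.ofCore core.toCore
    refine exists_det_eq_one_and_isLeast_prod_minima i hispan O hOspan ht0 p b₀ ?_ minJ ?_
    · rw [hb₀, hbspan]
      exact hΛO
    · rw [hb₀, hbspan]
      exact hminJ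
  have hψ : Function.Injective ψ :=
    (LinearMap.equivOfDetNeZero ψ (hdet.trans_ne one_ne_zero)).injective
  refine ⟨_, ψ ∘ b, hb.map' (ψ.restrictScalars ℤ) (LinearMap.ker_eq_bot.2 hψ), rfl, ?_, ?_⟩
  · have := det_bilinForm_map F b₀ ψ
    rw [hdet, one_pow, one_mul, hb₀] at this
    exact this.trans hvol
  · convert hleast using 1
    ext s
    have hspan : Submodule.span ℤ (Set.range (ψ ∘ b)) = Λ.map (ψ.restrictScalars ℤ) := by
      rw [← hbspan, Submodule.map_span, Set.range_comp]
      rfl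
    rw [hb₀, hbspan]
    constructor
    · rintro ⟨_, hy, hy0, rfl⟩
      rw [hspan] at hy
      obtain ⟨x, hx, rfl⟩ := hy
      exact ⟨x, hx, fun h => hy0 (by simp [h]), rfl⟩
    · rintro ⟨x, hx, hx0, rfl⟩
      exact ⟨ψ x, hspan ▸ ⟨x, hx, rfl⟩, (map_ne_zero_iff ψ hψ).2 hx0, rfl⟩
end

section
/- Let m be a positive integer such that 2 has odd multiplicative order modulo m. Then the quaternion algebra (−1,−1 / Q(ζ_m)) = Q(ζ_m) ⊗_Q (−1,−1/Q) is a division algebra with center Q(ζ_m), and it contains a maximal Z[ζ_m]-order O whose unit group contains the subgroup 𝔗* × Z/mZ, where 𝔗* ≅ SL₂(F₃) is the binary tetrahedral group of order 24. -/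
open scoped Quaternion NumberField

theorem eq_zero_of_sq_add_mul_add_sq_eq_zero {A : Type*} [CommRing A] [CharP A 2] {f : ℕ}
    (hf : Odd f) (hA : ∀ x : A, x ^ 2 ^ f = x) {a b : A} (h : a ^ 2 + a * b + b ^ 2 = 0) :
    a = 0 ∧ b = 0 := by
  have hcube : a ^ 3 = b ^ 3 := by linear_combination (a - b) * h
  obtain ⟨n, hn⟩ : ∃ n, 3 * n + 1 = 2 * 2 ^ f := by
    have h1 : 2 ^ (f + 1) ≡ 1 [MOD 3] := by
      obtain ⟨k, hk⟩ := hf.add_one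
      rw [hk, ← two_mul, pow_mul]
      simpa using (show 2 ^ 2 ≡ 1 [MOD 3] by decide).pow k
    have h2 : (2 : ℕ) ^ (f + 1) = 2 * 2 ^ f := pow_succ' 2 f
    exact ⟨2 * 2 ^ f / 3, by unfold Nat.ModEq at h1; omega⟩
  have hpos : 0 < 2 ^ f := by positivity
  have key (x : A) : (x ^ 3) ^ n = x := by
    rw [← pow_mul, show 3 * n = 2 ^ f + (2 ^ f - 1) by omega, pow_add, hA, ← pow_succ',
      Nat.sub_add_cancel hpos, hA]
  have hab : a = b := by rw [← key a, hcube, key b]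
  subst hab
  have h2 : (2 : A) = 0 := CharTwo.two_eq_zero
  have ha : a ^ 2 = 0 := by linear_combination h - a ^ 2 * h2
  have : a = 0 := by
    rw [← hA a, ← Nat.sub_add_cancel (Nat.succ_le_of_lt (Nat.one_lt_two_pow hf.pos.ne')), pow_add]
    simp [ha]
  exact ⟨this, this⟩

theorem charP_two_quotient_span_two {R : Type*} [CommRing R]
    [Nontrivial (R ⧸ Ideal.span {(2 : R)})] : CharP (R ⧸ Ideal.span {(2 : R)}) 2 := by
  refine CharTwo.of_one_ne_zero_of_two_eq_zero one_ne_zero ?_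
  rw [← map_ofNat (Ideal.Quotient.mk _), Ideal.Quotient.eq_zero_iff_mem]
  exact Ideal.mem_span_singleton_self _

theorem cyclotomic_two_dvd_pow_sub {m : ℕ} [NeZero m] {K : Type*} [Field K] [NumberField K]
    [IsCyclotomicExtension {m} ℚ K] (x : 𝓞 K) :
    2 ∣ x ^ 2 ^ orderOf (2 : ZMod m) - x := by
  set f := orderOf (2 : ZMod m)
  have hζ := IsCyclotomicExtension.zeta_spec m ℚ K
  have hx : x ∈ Algebra.adjoin ℤ {hζ.toInteger} := by
    rw [IsCyclotomicExtension.Rat.adjoin_singleton_eq_top]; trivial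
  rw [← Ideal.mem_span_singleton, ← Ideal.Quotient.eq, map_pow]
  rcases subsingleton_or_nontrivial (𝓞 K ⧸ Ideal.span {(2 : 𝓞 K)})
  · exact Subsingleton.elim _ _
  have : CharP (𝓞 K ⧸ Ideal.span {(2 : 𝓞 K)}) 2 :=
    charP_two_quotient_span_two
  induction hx using Algebra.adjoin_induction with
  | mem x hx =>
    rw [Set.mem_singleton_iff] at hx
    subst hx
    rw [← map_pow]
    congr 1
    have h1 : 2 ^ f ≡ 1 [MOD m] := by
      rw [← ZMod.natCast_eq_natCast_iff]
      push_cast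
      exact pow_orderOf_eq_one _
    have h3 := hζ.toInteger_isPrimitiveRoot.eq_orderOf ▸ h1
    simpa using pow_eq_pow_of_modEq h3 (pow_orderOf_eq_one _)
  | algebraMap r =>
    rw [algebraMap_int_eq, eq_intCast, map_intCast, ← iterate_frobenius, ← RingHom.coe_pow]
    exact map_intCast _ r
  | add x y _ _ hx hy => rw [map_add, add_pow_char_pow, hx, hy]
  | mul x y _ _ hx hy => rw [map_mul, mul_pow, hx, hy]

theorem not_isUnit_two_ringOfIntegers (K : Type*) [Field K] [NumberField K] :
    ¬ IsUnit (2 : 𝓞 K) := by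
  intro h
  have h' : IsUnit (algebraMap ℤ (𝓞 K) 2) := by simpa using h
  exact absurd (isUnit_of_map_unit (algebraMap ℤ (𝓞 K)) 2 h') (by decide)

theorem cyclotomic_two_dvd_of_dvd_sq_add_mul_add_sq {m : ℕ} [NeZero m] {K : Type*} [Field K]
    [NumberField K] [IsCyclotomicExtension {m} ℚ K] (hm : Odd (orderOf (2 : ZMod m)))
    {a b : 𝓞 K} (h : 2 ∣ a ^ 2 + a * b + b ^ 2) : 2 ∣ a ∧ 2 ∣ b := by
  have hnt : Nontrivial (𝓞 K ⧸ Ideal.span {(2 : 𝓞 K)}) := by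
    rw [Ideal.Quotient.nontrivial_iff, Ne, Ideal.span_singleton_eq_top]
    exact not_isUnit_two_ringOfIntegers K
  have : CharP (𝓞 K ⧸ Ideal.span {(2 : 𝓞 K)}) 2 :=
    charP_two_quotient_span_two
  simp only [← Ideal.mem_span_singleton, ← Ideal.Quotient.eq_zero_iff_mem] at h ⊢
  refine eq_zero_of_sq_add_mul_add_sq_eq_zero hm (fun x => ?_) (by simpa using h)
  obtain ⟨x, rfl⟩ := Ideal.Quotient.mk_surjective x
  rw [← map_pow, Ideal.Quotient.eq, Ideal.mem_span_singleton]
  exact cyclotomic_two_dvd_pow_sub x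

/-- If four squares add up to a multiple of four, their bases are congruent modulo two, provided
that `X ^ 2 + X * Y + Y ^ 2` is anisotropic modulo two. -/
theorem two_dvd_sub_of_four_dvd_sum_sq {R : Type*} [CommRing R] [IsDomain R] [CharZero R]
    (hR : ∀ {a b : R}, 2 ∣ a ^ 2 + a * b + b ^ 2 → 2 ∣ a ∧ 2 ∣ b) {a b c d : R}
    (hadd : 2 ∣ a + b + c + d) (h : 4 ∣ a ^ 2 + b ^ 2 + c ^ 2 + d ^ 2) :
    2 ∣ a - d ∧ 2 ∣ b - d ∧ 2 ∣ c - d := by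
  obtain ⟨y, hy⟩ := hadd
  obtain ⟨z, hz⟩ := h
  have key : 2 ∣ (a + b) ^ 2 + (a + b) * (a + c) + (a + c) ^ 2 := by
    refine ⟨z - y ^ 2 + y * (a + b + c) + a ^ 2 + a * b + a * c,
      mul_left_cancel₀ (two_ne_zero (α := R)) ?_⟩
    obtain rfl : d = 2 * y - a - b - c := by linear_combination hy
    linear_combination hz
  obtain ⟨⟨p, hp⟩, ⟨q, hq⟩⟩ := hR key
  exact ⟨⟨p + q - y, by linear_combination hp + hq - hy⟩,
    ⟨2 * p + q - y - a, by linear_combination 2 * hp + hq - hy⟩,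
    ⟨p + 2 * q - y - a, by linear_combination hp + 2 * hq - hy⟩⟩

theorem two_dvd_of_sum_sq_eq_zero {R : Type*} [CommRing R] [IsDomain R] [CharZero R]
    (hR : ∀ {a b : R}, 2 ∣ a ^ 2 + a * b + b ^ 2 → 2 ∣ a ∧ 2 ∣ b) {a b c d : R}
    (h : a ^ 2 + b ^ 2 + c ^ 2 + d ^ 2 = 0) :
    2 ∣ a ∧ 2 ∣ b ∧ 2 ∣ c ∧ 2 ∣ d := by
  have hadd : 2 ∣ a + b + c + d := by
    refine (hR (b := 0) ?_).1
    exact ⟨a * b + a * c + a * d + b * c + b * d + c * d, by linear_combination h⟩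
  obtain ⟨⟨p, hp⟩, ⟨q, hq⟩, ⟨r, hr⟩⟩ := two_dvd_sub_of_four_dvd_sum_sq hR hadd (h ▸ dvd_zero 4)
  obtain rfl : a = d + 2 * p := by linear_combination hp
  obtain rfl : b = d + 2 * q := by linear_combination hq
  obtain rfl : c = d + 2 * r := by linear_combination hr
  have key : 2 ∣ d ^ 2 + d * (p + q + r) + (p + q + r) ^ 2 := by
    refine ⟨p * q + p * r + q * r, mul_left_cancel₀ (OfNat.ofNat_ne_zero 4 : (4 : R) ≠ 0) ?_⟩
    linear_combination h
  have hd := (hR key).1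
  simp [dvd_add, hd]

theorem eq_zero_of_sum_sq_eq_zero {R : Type*} [CommRing R] [IsDomain R] [CharZero R]
    [IsNoetherianRing R] (h2 : ¬ IsUnit (2 : R))
    (hR : ∀ {a b : R}, 2 ∣ a ^ 2 + a * b + b ^ 2 → 2 ∣ a ∧ 2 ∣ b) {a b c d : R}
    (h : a ^ 2 + b ^ 2 + c ^ 2 + d ^ 2 = 0) : a = 0 := by
  by_contra ha
  refine FiniteMultiplicity.not_iff_forall.2 (fun n => ?_) (FiniteMultiplicity.of_not_isUnit h2 ha)
  clear ha
  induction n generalizing a b c d with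
  | zero => simp
  | succ n ih =>
    obtain ⟨⟨a, rfl⟩, ⟨b, rfl⟩, ⟨c, rfl⟩, ⟨d, rfl⟩⟩ := two_dvd_of_sum_sq_eq_zero hR h
    rw [pow_succ']
    refine mul_dvd_mul_left 2 (ih (b := b) (c := c) (d := d) ?_)
    refine mul_left_cancel₀ (OfNat.ofNat_ne_zero 4 : (4 : R) ≠ 0) ?_
    linear_combination h

section Hurwitz

variable (K : Type*) [Field K]

theorem algebraMap_ringOfIntegers_two : algebraMap (𝓞 K) K 2 = 2 := map_ofNat _ 2

theorem coe_ringOfIntegers_two : ((2 : 𝓞 K) : K) = 2 := map_ofNat (algebraMap (𝓞 K) K) 2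

theorem algebraMap_ringOfIntegers_four : algebraMap (𝓞 K) K 4 = 4 := map_ofNat _ 4

/-- The Hurwitz order over the ring of integers of `K`: the `𝓞 K`-span of `1`, `i`, `j` and
`(1 + i + j + k) / 2`. -/
def hurwitzOrder [NumberField K] : Subring ℍ[K, -1, -1] where
  carrier := {x | ∃ p q r s : 𝓞 K, x = ⟨p + s / 2, q + s / 2, r + s / 2, s / 2⟩}
  zero_mem' := ⟨0, 0, 0, 0, by ext <;> simp⟩
  one_mem' := ⟨1, 0, 0, 0, by ext <;> simp⟩
  add_mem' := by
    rintro _ _ ⟨p, q, r, s, rfl⟩ ⟨p', q', r', s', rfl⟩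
    refine ⟨p + p', q + q', r + r', s + s', ?_⟩
    ext <;> simp <;> ring
  neg_mem' := by
    rintro _ ⟨p, q, r, s, rfl⟩
    refine ⟨-p, -q, -r, -s, ?_⟩
    ext <;> simp <;> ring
  mul_mem' := by
    rintro _ _ ⟨p, q, r, s, rfl⟩ ⟨p', q', r', s', rfl⟩
    refine ⟨p * p' - q * q' - r * r' - s * s' - q * s' - s * r' - q * r' + r * q',
      p * q' + q * p' + r * s' + s * q' - s * r' - q * r' + r * q',
      p * r' + r * p' - q * s' + r * s' + s * q' - q * r' + r * q',
      p * s' + s * p' + s * s' + q * s' - r * s' - s * q' + s * r' + 2 * q * r' - 2 * r * q', ?_⟩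
    ext <;> simp [algebraMap_ringOfIntegers_two] <;> ring

variable {K}

theorem algebraMap_mul_mem_hurwitzOrder [NumberField K] (c : 𝓞 K) {x : ℍ[K, -1, -1]}
    (hx : x ∈ hurwitzOrder K) : algebraMap K ℍ[K, -1, -1] c * x ∈ hurwitzOrder K := by
  obtain ⟨p, q, r, s, rfl⟩ := hx
  refine ⟨c * p, c * q, c * r, c * s, ?_⟩
  rw [QuaternionAlgebra.algebraMap_eq]
  ext <;> simp <;> ring

instance [NumberField K] : Module.Finite ℤ (hurwitzOrder K) := by
  let f : (Fin 4 → 𝓞 K) →+ hurwitzOrder K :=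
    { toFun := fun v => ⟨_, v 0, v 1, v 2, v 3, rfl⟩
      map_zero' := by ext <;> simp
      map_add' := fun v w => by ext <;> simp <;> ring }
  refine Module.Finite.of_surjective f.toIntLinearMap ?_
  rintro ⟨_, p, q, r, s, rfl⟩
  exact ⟨![p, q, r, s], rfl⟩

theorem i_mem_hurwitzOrder [NumberField K] : (⟨0, 1, 0, 0⟩ : ℍ[K, -1, -1]) ∈ hurwitzOrder K :=
  ⟨0, 1, 0, 0, by ext <;> simp⟩

theorem j_mem_hurwitzOrder [NumberField K] : (⟨0, 0, 1, 0⟩ : ℍ[K, -1, -1]) ∈ hurwitzOrder K :=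
  ⟨0, 0, 1, 0, by ext <;> simp⟩

theorem k_mem_hurwitzOrder [NumberField K] : (⟨0, 0, 0, 1⟩ : ℍ[K, -1, -1]) ∈ hurwitzOrder K :=
  ⟨-1, -1, -1, 2, by ext <;> simp [coe_ringOfIntegers_two]⟩

theorem omega_mem_hurwitzOrder [NumberField K] :
    (⟨1 / 2, 1 / 2, 1 / 2, 1 / 2⟩ : ℍ[K, -1, -1]) ∈ hurwitzOrder K :=
  ⟨0, 0, 0, 1, by ext <;> simp⟩

theorem span_hurwitzOrder [NumberField K] :
    Submodule.span K (hurwitzOrder K : Set ℍ[K, -1, -1]) = ⊤ := by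
  rw [eq_top_iff]
  intro x _
  have h : x = x.re • 1 + x.imI • ⟨0, 1, 0, 0⟩ + x.imJ • ⟨0, 0, 1, 0⟩ + x.imK • ⟨0, 0, 0, 1⟩ := by
    ext <;> simp
  have aux {y : ℍ[K, -1, -1]} (c : K) (hy : y ∈ hurwitzOrder K) :
      c • y ∈ Submodule.span K (hurwitzOrder K : Set ℍ[K, -1, -1]) :=
    Submodule.smul_mem _ _ (Submodule.subset_span hy)
  rw [h]
  exact add_mem (add_mem (add_mem (aux _ (one_mem _)) (aux _ i_mem_hurwitzOrder))
    (aux _ j_mem_hurwitzOrder)) (aux _ k_mem_hurwitzOrder)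

theorem isCentral_quaternion [NeZero (2 : K)] : Algebra.IsCentral K ℍ[K, -1, -1] where
  out x hx := by
    rw [Subalgebra.mem_center_iff] at hx
    have hi := hx ⟨0, 1, 0, 0⟩
    have hj := hx ⟨0, 0, 1, 0⟩
    have h2 : (2 : K) ≠ 0 := two_ne_zero
    have hI : x.imI = 0 := by
      have := congrArg QuaternionAlgebra.imK hj
      simp at this
      refine mul_left_cancel₀ h2 ?_
      linear_combination -this
    have hJ : x.imJ = 0 := by
      have := congrArg QuaternionAlgebra.imK hi
      simp at this
      refine mul_left_cancel₀ h2 ?_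
      linear_combination this
    have hK : x.imK = 0 := by
      have := congrArg QuaternionAlgebra.imJ hi
      simp at this
      refine mul_left_cancel₀ h2 ?_
      linear_combination -this
    exact Algebra.mem_bot.2 ⟨x.re, by ext <;> simp [hI, hJ, hK]⟩

theorem eq_zero_of_sum_sq_eq_zero_of_anisotropic_mod_two [NumberField K]
    (hK : ∀ {a b : 𝓞 K}, 2 ∣ a ^ 2 + a * b + b ^ 2 → 2 ∣ a ∧ 2 ∣ b) {a b c d : K}
    (h : a ^ 2 + b ^ 2 + c ^ 2 + d ^ 2 = 0) : a = 0 := by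
  obtain ⟨⟨n, hn⟩, hint⟩ := IsLocalization.exist_integer_multiples (nonZeroDivisors (𝓞 K))
    Finset.univ ![a, b, c, d]
  have hn0 : (n : K) ≠ 0 := by simpa using nonZeroDivisors.ne_zero hn
  obtain ⟨a', ha⟩ := hint 0 (Finset.mem_univ _)
  obtain ⟨b', hb⟩ := hint 1 (Finset.mem_univ _)
  obtain ⟨c', hc⟩ := hint 2 (Finset.mem_univ _)
  obtain ⟨d', hd⟩ := hint 3 (Finset.mem_univ _)
  simp [Algebra.smul_def] at ha hb hc hd
  have h' : a' ^ 2 + b' ^ 2 + c' ^ 2 + d' ^ 2 = 0 := by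
    apply NumberField.RingOfIntegers.coe_injective
    simp only [map_add, map_pow, ha, hb, hc, hd, map_zero]
    linear_combination (n : K) ^ 2 * h
  have := eq_zero_of_sum_sq_eq_zero (not_isUnit_two_ringOfIntegers K) hK h'
  simpa [this, hn0] using ha.symm

theorem isUnit_quaternion_of_anisotropic (hK : ∀ {a b c d : K},
    a ^ 2 + b ^ 2 + c ^ 2 + d ^ 2 = 0 → a = 0) {x : ℍ[K, -1, -1]} (hx : x ≠ 0) : IsUnit x := by
  obtain ⟨a, b, c, d⟩ := x
  have hN : a ^ 2 + b ^ 2 + c ^ 2 + d ^ 2 ≠ 0 := by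
    intro h
    apply hx
    ext
    · exact hK h
    · exact hK (show b ^ 2 + a ^ 2 + c ^ 2 + d ^ 2 = 0 by linear_combination h)
    · exact hK (show c ^ 2 + a ^ 2 + b ^ 2 + d ^ 2 = 0 by linear_combination h)
    · exact hK (show d ^ 2 + a ^ 2 + b ^ 2 + c ^ 2 = 0 by linear_combination h)
  set N := a ^ 2 + b ^ 2 + c ^ 2 + d ^ 2 with hNdef
  refine isUnit_iff_exists.2 ⟨⟨a / N, -b / N, -c / N, -d / N⟩, ?_, ?_⟩ <;>
  ext <;> simp <;> field_simp <;> simp only [hNdef] <;> ring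

open Polynomial in
/-- The reduced trace and the reduced norm of an integral quaternion are integral. -/
theorem exists_trace_norm_of_isIntegral [NumberField K] {x : ℍ[K, -1, -1]} (hx : IsIntegral ℤ x) :
    (∃ t : 𝓞 K, (t : K) = 2 * x.re) ∧
      ∃ n : 𝓞 K, (n : K) = x.re ^ 2 + x.imI ^ 2 + x.imJ ^ 2 + x.imK ^ 2 := by
  set t := 2 * x.re with ht
  set n := x.re ^ 2 + x.imI ^ 2 + x.imJ ^ 2 + x.imK ^ 2 with hn
  by_cases hx' : ∃ c : K, algebraMap K _ c = x
  · obtain ⟨c, rfl⟩ := hx'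
    have hc : IsIntegral ℤ c :=
      (isIntegral_algebraMap_iff (QuaternionAlgebra.algebraMap_injective)).1 hx
    obtain ⟨c, rfl⟩ : ∃ c' : 𝓞 K, (c' : K) = c := ⟨⟨c, hc⟩, rfl⟩
    refine ⟨⟨2 * c, ?_⟩, ⟨c ^ 2, ?_⟩⟩ <;>
    simp [ht, hn, QuaternionAlgebra.algebraMap_eq, algebraMap_ringOfIntegers_two]
  · obtain ⟨p, hp, hpx⟩ := hx
    let g : K[X] := X ^ 2 - C t * X + C n
    have hg : g.Monic := by
      simp only [g]; monicity!
    have hgdeg : g.natDegree = 2 := by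
      simp only [g]; compute_degree!
    have hgx : aeval x g = 0 := by
      simp only [g, map_add, map_sub, map_mul, aeval_C, aeval_X,
        QuaternionAlgebra.algebraMap_eq, pow_two]
      ext <;> simp [ht, hn] <;> ring
    have hdvd : g ∣ p.map (algebraMap ℤ K) := by
      rw [← modByMonic_eq_zero_iff_dvd hg]
      have hrdeg : (p.map (algebraMap ℤ K) %ₘ g).natDegree ≤ 1 := by
        have := natDegree_modByMonic_lt (p.map (algebraMap ℤ K)) hg
          (fun h => by simp [h] at hgdeg)
        omega
      have hrx : aeval x (p.map (algebraMap ℤ K) %ₘ g) = 0 := by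
        have h := congrArg (aeval x) (modByMonic_add_div (p.map (algebraMap ℤ K)) g)
        rw [map_add, map_mul, hgx, zero_mul, add_zero, aeval_map_algebraMap] at h
        rw [h, aeval_def, hpx]
      generalize p.map (algebraMap ℤ K) %ₘ g = r at hrdeg hrx ⊢
      rw [eq_X_add_C_of_natDegree_le_one hrdeg] at hrx ⊢
      simp only [map_add, map_mul, aeval_C, aeval_X] at hrx
      have h1 : r.coeff 1 = 0 := by
        by_contra h1
        refine hx' ⟨-(r.coeff 1)⁻¹ * r.coeff 0, ?_⟩
        rw [map_mul, map_neg, eq_neg_of_add_eq_zero_right hrx, neg_mul_neg, ← mul_assoc,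
          ← map_mul, inv_mul_cancel₀ h1, map_one, one_mul]
      rw [h1, map_zero, zero_mul, zero_add, map_eq_zero_iff _ QuaternionAlgebra.algebraMap_injective]
        at hrx
      simp [h1, hrx]
    rw [IsScalarTower.algebraMap_eq ℤ (𝓞 K) K, ← Polynomial.map_map] at hdvd
    obtain ⟨g', hg'⟩ :=
      IsIntegrallyClosed.eq_map_mul_C_of_dvd K (hp.map (algebraMap ℤ (𝓞 K))) hdvd
    rw [hg.leadingCoeff, C_1, mul_one] at hg'
    refine ⟨⟨-g'.coeff 1, ?_⟩, ⟨g'.coeff 0, ?_⟩⟩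
    · change algebraMap (𝓞 K) K _ = _
      rw [map_neg, ← coeff_map, hg']
      simp [g, coeff_C]
    · change algebraMap (𝓞 K) K _ = _
      rw [← coeff_map, hg']
      simp [g, coeff_C]

theorem eq_hurwitzOrder_of_le [NumberField K]
    (hK : ∀ {a b : 𝓞 K}, 2 ∣ a ^ 2 + a * b + b ^ 2 → 2 ∣ a ∧ 2 ∣ b) (O : Subring ℍ[K, -1, -1])
    [Module.Finite ℤ O] (hO : hurwitzOrder K ≤ O) : O = hurwitzOrder K := by
  refine le_antisymm (fun x hx => ?_) hO
  have hint {y : ℍ[K, -1, -1]} (hy : y ∈ O) : IsIntegral ℤ y := by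
    have := Algebra.IsIntegral.isIntegral (R := ℤ) (⟨y, hy⟩ : O)
    exact this.map O.subtype.toIntAlgHom
  obtain ⟨⟨a, ha⟩, n, hn⟩ := exists_trace_norm_of_isIntegral (hint hx)
  obtain ⟨⟨b, hb⟩, -⟩ := exists_trace_norm_of_isIntegral (hint (mul_mem hx (hO i_mem_hurwitzOrder)))
  obtain ⟨⟨c, hc⟩, -⟩ := exists_trace_norm_of_isIntegral (hint (mul_mem hx (hO j_mem_hurwitzOrder)))
  obtain ⟨⟨d, hd⟩, -⟩ := exists_trace_norm_of_isIntegral (hint (mul_mem hx (hO k_mem_hurwitzOrder)))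
  obtain ⟨⟨t, ht⟩, -⟩ :=
    exists_trace_norm_of_isIntegral (hint (mul_mem hx (hO omega_mem_hurwitzOrder)))
  simp at hb hc hd ht
  obtain ⟨⟨p, hp⟩, ⟨q, hq⟩, ⟨r, hr⟩⟩ := two_dvd_sub_of_four_dvd_sum_sq hK
    (a := a) (b := -b) (c := -c) (d := -d)
    ⟨t - b - c - d, by
      apply NumberField.RingOfIntegers.coe_injective
      simp [ha, hb, hc, hd, ht, algebraMap_ringOfIntegers_two]; ring⟩
    ⟨n, by
      apply NumberField.RingOfIntegers.coe_injective
      simp [ha, hb, hc, hd, hn, algebraMap_ringOfIntegers_four]; ring⟩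
  apply_fun ((↑) : 𝓞 K → K) at hp hq hr
  simp [ha, hb, hc, hd, algebraMap_ringOfIntegers_two] at hp hq hr
  refine ⟨p, q, r, -d, ?_⟩
  ext <;> simp [hd]
  · linear_combination (1 / 2 : K) * hp
  · linear_combination (1 / 2 : K) * hq
  · linear_combination (1 / 2 : K) * hr

end Hurwitz

section BinaryTetrahedral

/-- Twice the coordinates, with respect to `1, i, j, k`, of the Hurwitz unit which reduces modulo
three to the matrix `!![p, q; r, s]` of determinant one, where `i` reduces to `!![0, -1; 1, 0]` and
`j` to `!![1, 1; 1, -1]`. -/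
def tetraCoord (p q r s : ZMod 3) : ℤ × ℤ × ℤ × ℤ :=
  let a := (-(p + s)).valMinAbs
  let b := (q - r).valMinAbs
  let c := (p + q + r - s).valMinAbs
  let d := (q + r + s - p).valMinAbs
  let e : ℤ := if a * b * c * d = 0 then 2 else -1
  (e * a, e * b, e * c, e * d)

theorem tetraCoord_parity : ∀ p q r s : ZMod 3, p * s - q * r = 1 →
    2 ∣ (tetraCoord p q r s).1 - (tetraCoord p q r s).2.2.2 ∧
    2 ∣ (tetraCoord p q r s).2.1 - (tetraCoord p q r s).2.2.2 ∧
    2 ∣ (tetraCoord p q r s).2.2.1 - (tetraCoord p q r s).2.2.2 := by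
  decide +kernel

theorem tetraCoord_mul : ∀ p q r s : ZMod 3, p * s - q * r = 1 →
    ∀ p' q' r' s' : ZMod 3, p' * s' - q' * r' = 1 →
    let x := tetraCoord p q r s
    let y := tetraCoord p' q' r' s'
    let z := tetraCoord (p * p' + q * r') (p * q' + q * s') (r * p' + s * r') (r * q' + s * s')
    2 * z.1 = x.1 * y.1 - x.2.1 * y.2.1 - x.2.2.1 * y.2.2.1 - x.2.2.2 * y.2.2.2 ∧
    2 * z.2.1 = x.1 * y.2.1 + x.2.1 * y.1 + x.2.2.1 * y.2.2.2 - x.2.2.2 * y.2.2.1 ∧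
    2 * z.2.2.1 = x.1 * y.2.2.1 - x.2.1 * y.2.2.2 + x.2.2.1 * y.1 + x.2.2.2 * y.2.1 ∧
    2 * z.2.2.2 = x.1 * y.2.2.2 + x.2.1 * y.2.2.1 - x.2.2.1 * y.2.1 + x.2.2.2 * y.1 := by
  decide +kernel

theorem tetraCoord_of_scalar : ∀ p q r s : ZMod 3, p * s - q * r = 1 →
    (tetraCoord p q r s).2.1 = 0 → (tetraCoord p q r s).2.2.1 = 0 →
    (tetraCoord p q r s).2.2.2 = 0 →
    ((tetraCoord p q r s).1 = 2 ∧ p = 1 ∧ q = 0 ∧ r = 0 ∧ s = 1) ∨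
      (tetraCoord p q r s).1 = -2 := by
  decide +kernel

theorem specialLinearGroup_fin_two_det {R : Type*} [CommRing R]
    (M : Matrix.SpecialLinearGroup (Fin 2) R) : M 0 0 * M 1 1 - M 0 1 * M 1 0 = 1 := by
  rw [← Matrix.det_fin_two]
  exact M.det_coe

variable (K : Type*) [Field K] [NumberField K]

open Matrix in
/-- The embedding of `SL₂(𝔽₃)` into the Hurwitz quaternions which splits reduction modulo three. -/
def binaryTetrahedralHom : SpecialLinearGroup (Fin 2) (ZMod 3) →* ℍ[K, -1, -1] where
  toFun M :=
    let x := tetraCoord (M 0 0) (M 0 1) (M 1 0) (M 1 1)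
    ⟨x.1 / 2, x.2.1 / 2, x.2.2.1 / 2, x.2.2.2 / 2⟩
  map_one' := by
    have : tetraCoord 1 0 0 1 = (2, 0, 0, 0) := by decide +kernel
    ext <;> simp [this]
  map_mul' M N := by
    obtain ⟨h1, h2, h3, h4⟩ := tetraCoord_mul _ _ _ _ (specialLinearGroup_fin_two_det M)
      _ _ _ _ (specialLinearGroup_fin_two_det N)
    apply_fun ((↑) : ℤ → K) at h1 h2 h3 h4
    push_cast at h1 h2 h3 h4
    ext <;> simp [mul_apply, Fin.sum_univ_two]
    · linear_combination (1 / 4 : K) * h1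
    · linear_combination (1 / 4 : K) * h2
    · linear_combination (1 / 4 : K) * h3
    · linear_combination (1 / 4 : K) * h4

variable {K}

theorem binaryTetrahedralHom_mem (M : Matrix.SpecialLinearGroup (Fin 2) (ZMod 3)) :
    binaryTetrahedralHom K M ∈ hurwitzOrder K := by
  obtain ⟨⟨p, hp⟩, ⟨q, hq⟩, ⟨r, hr⟩⟩ :=
    tetraCoord_parity _ _ _ _ (specialLinearGroup_fin_two_det M)
  apply_fun ((↑) : ℤ → K) at hp hq hr
  push_cast at hp hq hr
  refine ⟨p, q, r, ((tetraCoord (M 0 0) (M 0 1) (M 1 0) (M 1 1)).2.2.2 : ℤ), ?_⟩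
  ext <;> simp [binaryTetrahedralHom]
  · linear_combination (1 / 2 : K) * hp
  · linear_combination (1 / 2 : K) * hq
  · linear_combination (1 / 2 : K) * hr

theorem eq_one_or_eq_neg_one_of_binaryTetrahedralHom_eq
    {M : Matrix.SpecialLinearGroup (Fin 2) (ZMod 3)} {c : K}
    (h : binaryTetrahedralHom K M = algebraMap K _ c) : (c = 1 ∧ M = 1) ∨ c = -1 := by
  rw [QuaternionAlgebra.algebraMap_eq, QuaternionAlgebra.ext_iff] at h
  simp [binaryTetrahedralHom] at h
  obtain ⟨h1, h2, h3, h4⟩ := h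
  rcases tetraCoord_of_scalar _ _ _ _ (specialLinearGroup_fin_two_det M) h2 h3 h4 with
    ⟨hc, h⟩ | hc
  · refine .inl ⟨?_, ?_⟩
    · rw [← h1, hc]; norm_num
    · ext i j
      fin_cases i <;> fin_cases j <;> simp [h]
  · right
    rw [← h1, hc]; norm_num

theorem exists_subgroup_units_hurwitzOrder {m : ℕ} (hm : Odd m) {ζ : (𝓞 K)ˣ}
    (hζ : IsPrimitiveRoot ζ m) : ∃ G : Subgroup (hurwitzOrder K)ˣ, Nonempty
      (G ≃* (Matrix.SpecialLinearGroup (Fin 2) (ZMod 3) × Multiplicative (ZMod m))) := by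
  have : NeZero m := ⟨hm.pos.ne'⟩
  let χ : Multiplicative (ZMod m) →* (𝓞 K)ˣ :=
    (Subgroup.subtype _).comp hζ.zmodEquivZPowers.toMultiplicativeLeft.toMonoidHom
  have hχ : Function.Injective χ :=
    Subtype.val_injective.comp hζ.zmodEquivZPowers.toMultiplicativeLeft.injective
  let χ' : Multiplicative (ZMod m) →* ℍ[K, -1, -1] :=
    ((algebraMap K ℍ[K, -1, -1]).comp (algebraMap (𝓞 K) K)).toMonoidHom.comp
      ((Units.coeHom (𝓞 K)).comp χ)
  let f : Matrix.SpecialLinearGroup (Fin 2) (ZMod 3) × Multiplicative (ZMod m) →*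
      ℍ[K, -1, -1] :=
    MonoidHom.noncommCoprod (binaryTetrahedralHom K) χ' fun M z =>
      (Algebra.commutes (algebraMap (𝓞 K) K (χ z)) (binaryTetrahedralHom K M)).symm
  have hf (x) : f x ∈ hurwitzOrder K := by
    refine mul_mem (binaryTetrahedralHom_mem x.1) ?_
    have := algebraMap_mul_mem_hurwitzOrder (χ x.2 : 𝓞 K) (one_mem (hurwitzOrder K))
    rwa [mul_one] at this
  let F : Matrix.SpecialLinearGroup (Fin 2) (ZMod 3) × Multiplicative (ZMod m) →*
      (hurwitzOrder K)ˣ := (f.codRestrict (hurwitzOrder K) hf).toHomUnits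
  have hF : Function.Injective F := by
    rw [injective_iff_map_eq_one]
    rintro ⟨M, z⟩ h
    have h1 : binaryTetrahedralHom K M * χ' z = 1 := congrArg (fun u => (u.1 : ℍ[K, -1, -1])) h
    have h2 : binaryTetrahedralHom K M = algebraMap K _ (algebraMap (𝓞 K) K (χ z⁻¹)) := by
      change _ = χ' z⁻¹
      rw [← mul_one (binaryTetrahedralHom K M), ← map_one χ', ← mul_inv_cancel z, map_mul,
        ← mul_assoc, h1, one_mul]
    rcases eq_one_or_eq_neg_one_of_binaryTetrahedralHom_eq h2 with ⟨h3, rfl⟩ | h3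
    · rw [map_eq_one_iff _ NumberField.RingOfIntegers.coe_injective, Units.val_eq_one,
        map_eq_one_iff χ hχ, inv_eq_one] at h3
      rw [h3]; rfl
    · have h4 : (z⁻¹) ^ m = 1 := by
        have := pow_card_eq_one' (x := z⁻¹)
        simpa using this
      have h5 : (algebraMap (𝓞 K) K (χ z⁻¹)) ^ m = 1 := by
        rw [← map_pow, ← Units.val_pow_eq_pow_val, ← map_pow, h4]; simp
      rw [h3, hm.neg_one_pow] at h5
      norm_num at h5
  exact ⟨F.range, ⟨(MonoidHom.ofInjective hF).symm⟩⟩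

end BinaryTetrahedral

/-- **Quaternion algebras over cyclotomic fields (after Amitsur).**
Let `m` be a positive integer such that `2` has odd multiplicative order modulo `m`. Then the
quaternion algebra `(−1,−1 / ℚ(ζ_m))` is a division algebra with center `ℚ(ζ_m)`, and it
contains a maximal `ℤ[ζ_m]`-order `O` whose unit group contains a subgroup isomorphic to
`𝔗* × ℤ/mℤ`, where `𝔗* ≅ SL₂(𝔽₃)` is the binary tetrahedral group of order `24`. -/
theorem stmt19 (m : ℕ+) (h2 : Odd (orderOf (2 : ZMod m))) :
    -- `(−1,−1 / ℚ(ζ_m))` is a division algebra: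
    (∀ x : ℍ[CyclotomicField m ℚ, -1, -1], x ≠ 0 → IsUnit x) ∧
    -- with center `ℚ(ζ_m)`:
    Algebra.IsCentral (CyclotomicField m ℚ) ℍ[CyclotomicField m ℚ, -1, -1] ∧
    -- and it has a maximal `ℤ[ζ_m] = 𝓞 (ℚ(ζ_m))`-order `O` …
    ∃ O : Subring ℍ[CyclotomicField m ℚ, -1, -1],
      (∀ c : 𝓞 (CyclotomicField m ℚ), ∀ x ∈ O,
        algebraMap (CyclotomicField m ℚ) ℍ[CyclotomicField m ℚ, -1, -1] c * x ∈ O) ∧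
      Module.Finite ℤ O ∧
      Submodule.span (CyclotomicField m ℚ) (O : Set ℍ[CyclotomicField m ℚ, -1, -1]) = ⊤ ∧
      (∀ O' : Subring ℍ[CyclotomicField m ℚ, -1, -1],
        (∀ c : 𝓞 (CyclotomicField m ℚ), ∀ x ∈ O',
          algebraMap (CyclotomicField m ℚ) ℍ[CyclotomicField m ℚ, -1, -1] c * x ∈ O') →
        Module.Finite ℤ O' →
        Submodule.span (CyclotomicField m ℚ) (O' : Set ℍ[CyclotomicField m ℚ, -1, -1]) = ⊤ →
        O ≤ O' → O' = O) ∧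
      -- … whose unit group contains `𝔗* × ℤ/mℤ` with `𝔗* ≅ SL₂(𝔽₃)`:
      ∃ G : Subgroup Oˣ, Nonempty
        (G ≃* (Matrix.SpecialLinearGroup (Fin 2) (ZMod 3) × Multiplicative (ZMod m))) := by
  have hinst : IsCyclotomicExtension {(m : ℕ)} ℚ (CyclotomicField m ℚ) :=
    CyclotomicField.isCyclotomicExtension _ _
  have hK {a b : 𝓞 (CyclotomicField m ℚ)} (h : 2 ∣ a ^ 2 + a * b + b ^ 2) : 2 ∣ a ∧ 2 ∣ b :=
    cyclotomic_two_dvd_of_dvd_sq_add_mul_add_sq (m := m) h2 h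
  have hm : Odd (m : ℕ) := by
    have h : IsUnit ((2 : ℕ) : ZMod m) := by
      exact_mod_cast (orderOf_pos_iff.1 h2.pos).isUnit
    rw [ZMod.isUnit_iff_coprime] at h
    exact Nat.coprime_two_left.1 h
  have hζ := (IsCyclotomicExtension.zeta_spec m ℚ
    (CyclotomicField m ℚ)).toInteger_isPrimitiveRoot
  refine ⟨fun x => isUnit_quaternion_of_anisotropic
      (eq_zero_of_sum_sq_eq_zero_of_anisotropic_mod_two hK),
    isCentral_quaternion, hurwitzOrder _, fun c x => algebraMap_mul_mem_hurwitzOrder c,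
    inferInstance, span_hurwitzOrder, fun O' _ _ _ hle => eq_hurwitzOrder_of_le hK O' hle,
    exists_subgroup_units_hurwitzOrder hm (hζ.isUnit_unit m.ne_zero)⟩
end
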